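/- arXiv:2411.13229 — 3 statements merged into one kernel-verified Lean document; each statement's English description precedes it below -/
import Mathlib

section
/- Let U and W be graphons. If there exist infinitely many odd integers k ≥ 3 and infinitely many even integers k ≥ 3 such that t(C_k, U) = t(C_k, W), then U and W have the same spectrum including multiplicities; that is, for every nonzero real number λ, the eigenspace {f ∈ L²([0,1]) : T_U f = λ f} and the eigenspace {f ∈ L²([0,1]) : T_W f = λ f} have the same (finite) dimension. -/
open MeasureTheory Set

noncomputable section

/-- Lebesgue measure restricted to `[0,1]`. -/
def μ01 : Measure ℝ := volume.restrict (Icc 0 1)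

instance : IsFiniteMeasure μ01 := by
  constructor
  rw [μ01, Measure.restrict_apply_univ]
  simp [Real.volume_Icc]

/-- A graphon: symmetric measurable `[0,1]`-valued kernel. -/
def IsGraphon (W : ℝ → ℝ → ℝ) : Prop :=
  Measurable (Function.uncurry W) ∧ (∀ x y, W x y = W y x) ∧ ∀ x y, W x y ∈ Icc (0:ℝ) 1

/-- Density `t(C_k, W)` of the `k`-cycle. -/
def cycleDensity (W : ℝ → ℝ → ℝ) (k : ℕ) : ℝ :=
  ∫ x : Fin k → ℝ in univ.pi fun _ => Icc (0:ℝ) 1, ∏ i, W (x i) (x (finRotate k i))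

/-- The integral operator associated with a kernel `W`. -/
def TW (W : ℝ → ℝ → ℝ) (f : ℝ → ℝ) : ℝ → ℝ := fun x => ∫ y, W x y * f y ∂μ01

/-- The `λ`-eigenspace (as a set of `L²` elements) of `T_W`. -/
def eigSet (W : ℝ → ℝ → ℝ) (lam : ℝ) : Set (Lp ℝ 2 μ01) :=
  {f | TW W ⇑f =ᵐ[μ01] fun x => lam * f x}

/-- Dimension of the `λ`-eigenspace of `T_W` (for a graphon `W` the eigenspace is a
linear subspace, hence equal to its span). -/
def eigRank (W : ℝ → ℝ → ℝ) (lam : ℝ) : Cardinal :=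
  Module.rank ℝ (Submodule.span ℝ (eigSet W lam))

/-- The cut norm distance `d_□`. -/
def cutNormDist (U W : ℝ → ℝ → ℝ) : ℝ :=
  sSup {d | ∃ S T : Set ℝ, MeasurableSet S ∧ MeasurableSet T ∧
    d = |∫ p in S ×ˢ T, (U p.1 p.2 - W p.1 p.2) ∂(μ01.prod μ01)|}

/-- A measure-preserving bijection of `[0,1]`. -/
def IsMPBij (φ : ℝ → ℝ) : Prop :=
  BijOn φ (Icc 0 1) (Icc 0 1) ∧ MeasurePreserving φ μ01 μ01

/-- The cut distance `δ_□`. -/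
def cutDist (U W : ℝ → ℝ → ℝ) : ℝ :=
  sInf {d | ∃ φ : ℝ → ℝ, IsMPBij φ ∧ d = cutNormDist (fun x y => U (φ x) (φ y)) W}

/-- `L¹`-norm on `[0,1]²`. -/
def L1norm (W : ℝ → ℝ → ℝ) : ℝ := ∫ p, |W p.1 p.2| ∂(μ01.prod μ01)

/-- Square of the `L²`-norm on `[0,1]²`. -/
def L2normSq (W : ℝ → ℝ → ℝ) : ℝ := ∫ p, (W p.1 p.2) ^ 2 ∂(μ01.prod μ01)

/-- A `{0,1}`-valued graphon. -/
def ZeroOneValued (W : ℝ → ℝ → ℝ) : Prop :=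
  ∀ᵐ p ∂(μ01.prod μ01), W p.1 p.2 = 0 ∨ W p.1 p.2 = 1

section AuxiliaryResults

open Filter
open scoped Topology InnerProductSpace

/-- An even weight on the line, bounded below in absolute value on its support, vanishes away from `0`
if infinitely many of its absolute moments vanish. -/
theorem eq_zero_of_frequently_tsum_abs_pow_eq_zero {g : ℝ → ℝ} (hg : ∀ x, g x ≠ 0 → 1 ≤ |g x|)
    (heven : ∀ x, g (-x) = g x) (hsum : Summable fun x => |g x| * |x| ^ 2)
    (hzero : ∃ᶠ k in atTop, ∑' x, g x * |x| ^ k = 0) {x : ℝ} (hx : x ≠ 0) : g x = 0 := by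
  by_contra hgx
  have hfin : {y : ℝ | g y ≠ 0 ∧ |x| ≤ |y|}.Finite := by
    have h := (hsum.tendsto_cofinite_zero.eventually_lt_const (pow_pos (abs_pos.2 hx) 2))
    refine Set.Finite.subset (eventually_cofinite.1 h) fun y hy => ?_
    simp only [mem_ofPred_eq, not_lt] at hy ⊢
    calc |x| ^ 2 ≤ 1 * |y| ^ 2 := by
          rw [one_mul]; exact pow_le_pow_left₀ (abs_nonneg x) hy.2 2
      _ ≤ |g y| * |y| ^ 2 := mul_le_mul_of_nonneg_right (hg y hy.1) (by positivity)
  obtain ⟨r, ⟨hr, hxr⟩, hmax⟩ := Set.exists_max_image _ (fun y => |y|) hfin ⟨x, hgx, le_rfl⟩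
  have hr0 : 0 < |r| := (abs_pos.2 hx).trans_le hxr
  have hr0' : r ≠ 0 := abs_pos.1 hr0
  have hvanish : ∀ y, |r| < |y| → g y = 0 := fun y hy => by
    by_contra h
    exact absurd (hmax y ⟨h, hxr.trans hy.le⟩) (not_le.2 hy)
  have hlim : Tendsto (fun k : ℕ => ∑' y, g y * (|y| / |r|) ^ k) atTop
      (𝓝 (∑' y, if |y| = |r| then g y else 0)) := by
    refine tendsto_tsum_of_dominated_convergence (hsum.mul_right (|r| ^ 2)⁻¹) ?_ ?_
    · intro y
      rcases lt_trichotomy |y| |r| with h | h | h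
      · rw [if_neg h.ne]
        simpa using (tendsto_pow_atTop_nhds_zero_of_lt_one (by positivity)
          ((div_lt_one hr0).2 h)).const_mul (g y)
      · simp [h, hr0.ne']
      · simp [hvanish y h]
    · filter_upwards [eventually_ge_atTop 2] with k hk y
      rcases le_or_gt |y| |r| with h | h
      · rw [norm_mul, norm_pow, Real.norm_eq_abs, Real.norm_eq_abs,
          abs_of_nonneg (div_nonneg (abs_nonneg y) hr0.le), mul_assoc, ← div_eq_mul_inv, ← div_pow]
        exact mul_le_mul_of_nonneg_left
          (pow_le_pow_of_le_one (by positivity) ((div_le_one hr0).2 h) hk) (abs_nonneg _)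
      · simp [hvanish y h]
  have hval : (∑' y, if |y| = |r| then g y else 0) = 2 * g r := by
    have hne : r ≠ -r := fun h => hr0' (by linarith)
    rw [tsum_eq_sum (s := {r, -r})]
    · rw [Finset.sum_pair hne]
      simp [heven, two_mul]
    · intro y hy
      rw [if_neg]
      simpa [abs_eq_abs] using hy
  have hfreq : ∃ᶠ k : ℕ in atTop, ∑' y, g y * (|y| / |r|) ^ k = 0 := by
    refine hzero.mono fun k hk => ?_
    simp_rw [div_pow, div_eq_mul_inv, ← mul_assoc]
    rw [tsum_mul_right, hk, zero_mul]
  have : 2 * g r = 0 := by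
    rw [← hval]
    by_contra hne
    exact hfreq (hlim.eventually_ne hne)
  exact hr (by linarith)

/-- An integer-valued weight on the line vanishes away from `0` if infinitely many of its odd moments
and infinitely many of its even moments vanish. -/
theorem eq_zero_of_infinite_moments {d : ℝ → ℤ}
    (hsummable : ∀ {k : ℕ}, 2 ≤ k → Summable fun x : ℝ => (d x : ℝ) * x ^ k)
    (hodd : {k : ℕ | 2 ≤ k ∧ Odd k ∧ ∑' x : ℝ, (d x : ℝ) * x ^ k = 0}.Infinite)
    (heven : {k : ℕ | 2 ≤ k ∧ Even k ∧ ∑' x : ℝ, (d x : ℝ) * x ^ k = 0}.Infinite)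
    {x : ℝ} (hx : x ≠ 0) : d x = 0 := by
  have hsum : Summable fun y => |(d y : ℝ)| * |y| ^ 2 := by
    simpa only [abs_mul, abs_pow] using (hsummable le_rfl).abs
  have hneg : Summable fun y => |(d (-y) : ℝ)| * |y| ^ 2 := by
    simpa [Function.comp_def] using (Equiv.neg ℝ).summable_iff.2 hsum
  have hreflect : ∀ k : ℕ, ∑' y : ℝ, (d (-y) : ℝ) * (-y) ^ k = ∑' y : ℝ, (d y : ℝ) * y ^ k :=
    fun k => (Equiv.neg ℝ).tsum_eq fun y : ℝ => (d y : ℝ) * y ^ k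
  have hone : ∀ n : ℤ, (n : ℝ) ≠ 0 → 1 ≤ |(n : ℝ)| := fun n hn => by
    exact_mod_cast Int.one_le_abs (by exact_mod_cast hn)
  have hplus : (d x : ℝ) + d (-x) = 0 := by
    refine eq_zero_of_frequently_tsum_abs_pow_eq_zero (g := fun y => (d y : ℝ) + d (-y))
      (fun y hy => ?_) (fun y => ?_) ?_ ?_ hx
    · exact_mod_cast hone (d y + d (-y)) (by exact_mod_cast hy)
    · rw [neg_neg, add_comm]
    · refine (hsum.add hneg).of_nonneg_of_le (fun y => by positivity) fun y => ?_
      rw [← add_mul]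
      exact mul_le_mul_of_nonneg_right (abs_add_le _ _) (by positivity)
    · refine (Nat.frequently_atTop_iff_infinite.2 heven).mono fun k hk => ?_
      obtain ⟨hk2, hk, h0⟩ := hk
      have h1 := hsummable hk2
      have h2 := (Equiv.neg ℝ).summable_iff.2 h1
      have h3 := h1.tsum_add h2
      simp only [Function.comp_apply, Equiv.neg_apply] at h3
      rw [hreflect, h0, add_zero] at h3
      rw [← h3]
      simp only [hk.neg_pow, hk.pow_abs, add_mul]
  have hminus : SignType.sign x * ((d x : ℝ) - d (-x)) = 0 := by
    refine eq_zero_of_frequently_tsum_abs_pow_eq_zero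
      (g := fun y => SignType.sign y * ((d y : ℝ) - d (-y))) (fun y hy => ?_) (fun y => ?_) ?_ ?_ hx
    · exact_mod_cast hone (SignType.sign y * (d y - d (-y))) (by exact_mod_cast hy)
    · rw [neg_neg, Left.sign_neg, SignType.coe_neg]
      ring
    · refine (hsum.add hneg).of_nonneg_of_le (fun y => by positivity) fun y => ?_
      rw [← add_mul]
      refine mul_le_mul_of_nonneg_right ?_ (by positivity)
      rw [abs_mul]
      refine (mul_le_of_le_one_left (abs_nonneg _) ?_).trans (abs_sub _ _)
      cases SignType.sign y <;> simp
    · refine (Nat.frequently_atTop_iff_infinite.2 hodd).mono fun k hk => ?_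
      obtain ⟨hk2, hk, h0⟩ := hk
      have h1 := hsummable hk2
      have h2 := (Equiv.neg ℝ).summable_iff.2 h1
      have h3 := h1.tsum_add h2
      simp only [Function.comp_apply, Equiv.neg_apply] at h3
      rw [hreflect, h0, add_zero] at h3
      rw [← h3]
      refine tsum_congr fun y => ?_
      have hy : (SignType.sign y : ℝ) * |y| ^ k = y ^ k := by
        rcases lt_trichotomy y 0 with h | h | h
        · simp [abs_of_neg h, sign_neg h, hk.neg_pow]
        · simp [h, hk.pos.ne']
        · simp [abs_of_pos h, sign_pos h]
      rw [mul_right_comm, hy, hk.neg_pow]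
      ring
  have hsign : (SignType.sign x : ℝ) ≠ 0 := by
    rcases hx.lt_or_gt with h | h
    · simp [sign_neg h]
    · simp [sign_pos h]
  have hsub := (mul_eq_zero.1 hminus).resolve_left hsign
  exact_mod_cast (by linarith : (d x : ℝ) = 0)

theorem Orthonormal.countable {E ι : Type*} [NormedAddCommGroup E] [InnerProductSpace ℝ E]
    [SecondCountableTopology E] {v : ι → E} (hv : Orthonormal ℝ v) : Countable ι := by
  refine Pairwise.countable_of_isOpen_disjoint (s := fun i => Metric.ball (v i) (1 / 2))
    (fun i j hij => Metric.ball_disjoint_ball ?_) (fun i => Metric.isOpen_ball)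
    fun i => Metric.nonempty_ball.2 (by norm_num)
  have h : ‖v i - v j‖ ^ 2 = 2 := by
    rw [norm_sub_sq_real, hv.1, hv.1, hv.2 hij]
    norm_num
  rw [dist_eq_norm]
  nlinarith [norm_nonneg (v i - v j)]

/-- A Hilbert–Schmidt operator is compact. -/
theorem ContinuousLinearMap.isCompactOperator_of_summable_norm_sq {E F ι : Type*}
    [NormedAddCommGroup E] [InnerProductSpace ℝ E] [CompleteSpace E]
    [NormedAddCommGroup F] [InnerProductSpace ℝ F] [CompleteSpace F]
    (e : HilbertBasis ι ℝ E) (T : E →L[ℝ] F) (hT : Summable fun i => ‖T (e i)‖ ^ 2) :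
    IsCompactOperator T := by
  let P : Finset ι → E →L[ℝ] F := fun s => ∑ i ∈ s, (innerSL ℝ (e i)).smulRight (T (e i))
  have hP : ∀ s, IsCompactOperator (P s) := fun s => by
    refine Finset.sum_induction _ (fun S : E →L[ℝ] F => IsCompactOperator S)
      (fun _ _ h₁ h₂ => h₁.add h₂) isCompactOperator_zero fun i _ => ?_
    exact (isCompactOperator_of_locallyCompactSpace_rng
      (ContinuousLinearMap.toSpanSingleton ℝ (T (e i)))).comp_clm (innerSL ℝ (e i))
  have happly : ∀ s f, P s f = ∑ i ∈ s, ⟪e i, f⟫_ℝ • T (e i) := fun s f => by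
    simp [P]
  have hmem : T ∈ closure {S : E →L[ℝ] F | IsCompactOperator S} := by
    refine Metric.mem_closure_iff.2 fun ε hε => ?_
    obtain ⟨s, hs⟩ := summable_iff_vanishing_norm.1 hT ((ε / 2) ^ 2) (by positivity)
    refine ⟨P s, hP s, ?_⟩
    rw [dist_eq_norm]
    refine (ContinuousLinearMap.opNorm_le_bound _ (by positivity) fun f => ?_).trans_lt
      (half_lt_self hε)
    have hsum : HasSum (fun i => ⟪e i, f⟫_ℝ • T (e i)) (T f) := by
      simpa [HilbertBasis.repr_apply_apply] using (e.hasSum_repr f).mapL T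
    have hlim := (Tendsto.sub_const hsum (P s f)).norm
    refine le_of_tendsto hlim ?_
    filter_upwards [eventually_ge_atTop s] with t hst
    classical
    rw [happly, ← Finset.sum_sdiff hst, add_sub_cancel_right]
    have hbessel : ∑ i ∈ t \ s, ‖⟪e i, f⟫_ℝ‖ ^ 2 ≤ ‖f‖ ^ 2 :=
      e.orthonormal.sum_inner_products_le f
    have htail : ∑ i ∈ t \ s, ‖T (e i)‖ ^ 2 ≤ (ε / 2) ^ 2 := by
      refine ((le_abs_self _).trans (hs _ Finset.sdiff_disjoint).le)
    calc ‖∑ i ∈ t \ s, ⟪e i, f⟫_ℝ • T (e i)‖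
        ≤ ∑ i ∈ t \ s, ‖⟪e i, f⟫_ℝ‖ * ‖T (e i)‖ := by
          simpa only [norm_smul] using norm_sum_le (t \ s) fun i => ⟪e i, f⟫_ℝ • T (e i)
      _ ≤ √(∑ i ∈ t \ s, ‖⟪e i, f⟫_ℝ‖ ^ 2) * √(∑ i ∈ t \ s, ‖T (e i)‖ ^ 2) :=
          Real.sum_mul_le_sqrt_mul_sqrt _ _ _
      _ ≤ ‖f‖ * (ε / 2) := by
          gcongr
          · exact (Real.sqrt_le_left (norm_nonneg f)).2 hbessel
          · exact (Real.sqrt_le_left (by positivity)).2 htail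
      _ = ε / 2 * ‖f‖ := mul_comm _ _
  rwa [isClosed_setOfPred_isCompactOperator.closure_eq] at hmem

/-- A compact self-adjoint operator has a Hilbert basis of eigenvectors, indexed by the eigenvalues
and the multiplicities. -/
theorem ContinuousLinearMap.exists_eigenbasis {E : Type*}
    [NormedAddCommGroup E] [InnerProductSpace ℝ E] [CompleteSpace E] {T : E →L[ℝ] E}
    (hT : IsCompactOperator T) (hT' : (T : E →ₗ[ℝ] E).IsSymmetric) :
    ∃ (w : (c : ℝ) → Set (Module.End.eigenspace (T : E →ₗ[ℝ] E) c))
      (e : HilbertBasis (Σ c, w c) ℝ E), (∀ p, T (e p) = p.1 • e p) ∧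
      ∀ c ≠ 0, (w c).Finite ∧
        Module.rank ℝ (Module.End.eigenspace (T : E →ₗ[ℝ] E) c) = Nat.card (w c) := by
  choose w b hb using fun c => exists_hilbertBasis ℝ (Module.End.eigenspace (T : E →ₗ[ℝ] E) c)
  have hon : Orthonormal ℝ fun p : Σ c, w c => (b p.1 p.2 : E) :=
    hT'.orthogonalFamily_eigenspaces.orthonormal_sigma_orthonormal fun c => (b c).orthonormal
  have hsp : (Submodule.span ℝ (range fun p : Σ c, w c => (b p.1 p.2 : E)))ᗮ = ⊥ := by
    rw [eq_bot_iff, ← orthogonalComplement_iSup_eigenspaces_eq_bot hT hT',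
      ← Submodule.iInf_orthogonal]
    refine le_iInf fun c => ?_
    intro f hf
    rw [Submodule.mem_orthogonal]
    intro g hg
    have hzero : ∀ i, ⟪(b c i : E), f⟫_ℝ = 0 := fun i =>
      (Submodule.mem_orthogonal _ _).1 hf _ (Submodule.subset_span ⟨⟨c, i⟩, rfl⟩)
    have hsum := (((b c).hasSum_repr ⟨g, hg⟩).mapL
      (Submodule.subtypeL _)).mapL (innerSL ℝ f)
    have hzero' : ∀ i, ⟪f, (b c i : E)⟫_ℝ = 0 := fun i => by rw [real_inner_comm, hzero]
    simp only [map_smul, Submodule.subtypeL_apply, innerSL_apply_apply, hzero', smul_zero] at hsum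
    rw [real_inner_comm]
    exact hsum.unique hasSum_zero
  refine ⟨w, HilbertBasis.mkOfOrthogonalEqBot hon hsp, fun p => ?_, fun c hc => ?_⟩
  · rw [HilbertBasis.coe_mkOfOrthogonalEqBot]
    exact Module.End.mem_eigenspace_iff.1 (b p.1 p.2).2
  · have := finite_dimensional_eigenspace hT c hc
    have hfin : Finite (w c) := (b c).orthonormal.linearIndependent.finite
    have := Fintype.ofFinite (w c)
    refine ⟨hfin, ?_⟩
    rw [← Module.finrank_eq_rank, Module.finrank_eq_card_basis (b c).toOrthonormalBasis.toBasis,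
      Nat.card_eq_fintype_card]

/-- A jointly measurable kernel with values in `[-1, 1]`. -/
structure IsUnitKernel {α : Type*} [MeasurableSpace α] (K : α → α → ℝ) : Prop where
  measurable : Measurable (Function.uncurry K)
  abs_le : ∀ x y, |K x y| ≤ 1

namespace IsUnitKernel

variable {α : Type*} [MeasurableSpace α] {K L : α → α → ℝ}

theorem measurable_row (hK : IsUnitKernel K) (x : α) : Measurable (K x) :=
  hK.measurable.comp measurable_prodMk_left

theorem memLp_row (hK : IsUnitKernel K) (μ : Measure α) [IsProbabilityMeasure μ] (x : α) :
    MemLp (K x) 2 μ :=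
  MemLp.of_bound (hK.measurable_row x).aestronglyMeasurable 1 (ae_of_all _ (hK.abs_le x))

/-- The function `K x ·` as an element of `L²`. -/
def row (hK : IsUnitKernel K) (μ : Measure α) [IsProbabilityMeasure μ] (x : α) : Lp ℝ 2 μ :=
  (hK.memLp_row μ x).toLp

variable (μ : Measure α) [IsProbabilityMeasure μ]

theorem inner_row (hK : IsUnitKernel K) (x : α) (f : Lp ℝ 2 μ) :
    ⟪hK.row μ x, f⟫_ℝ = ∫ y, K x y * f y ∂μ := by
  rw [L2.inner_def]
  refine integral_congr_ae ?_
  filter_upwards [(hK.memLp_row μ x).coeFn_toLp] with y hy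
  rw [row, hy, RCLike.inner_apply, conj_trivial, mul_comm]

theorem inner_row_row (hK : IsUnitKernel K) (hL : IsUnitKernel L) (x : α) :
    ⟪hK.row μ x, hL.row μ x⟫_ℝ = ∫ y, K x y * L x y ∂μ := by
  rw [inner_row]
  refine integral_congr_ae ?_
  filter_upwards [(hL.memLp_row μ x).coeFn_toLp] with y hy
  rw [row, hy]

theorem norm_row_le (hK : IsUnitKernel K) (x : α) : ‖hK.row μ x‖ ≤ 1 := by
  have h : ∀ᵐ y ∂μ, ‖hK.row μ x y‖ ≤ 1 := by
    filter_upwards [(hK.memLp_row μ x).coeFn_toLp] with y hy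
    rw [row, hy]
    exact hK.abs_le x y
  simpa [measureUnivNNReal] using Lp.norm_le_of_ae_bound zero_le_one h

theorem abs_inner_row_le (hK : IsUnitKernel K) (x : α) (f : Lp ℝ 2 μ) :
    |⟪hK.row μ x, f⟫_ℝ| ≤ ‖f‖ :=
  (abs_real_inner_le_norm _ _).trans
    (mul_le_of_le_one_left (norm_nonneg f) (hK.norm_row_le μ x))

theorem aestronglyMeasurable_inner_row (hK : IsUnitKernel K) (f : Lp ℝ 2 μ) :
    AEStronglyMeasurable (fun x => ⟪hK.row μ x, f⟫_ℝ) μ := by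
  simp_rw [inner_row]
  have h : StronglyMeasurable (Function.uncurry fun x y => K x y * f y) :=
    hK.measurable.stronglyMeasurable.mul
      ((Lp.stronglyMeasurable f).comp_measurable measurable_snd)
  exact h.integral_prod_right.aestronglyMeasurable

theorem memLp_inner_row (hK : IsUnitKernel K) (f : Lp ℝ 2 μ) :
    MemLp (fun x => ⟪hK.row μ x, f⟫_ℝ) 2 μ :=
  MemLp.of_bound (hK.aestronglyMeasurable_inner_row μ f) ‖f‖
    (ae_of_all _ fun x => hK.abs_inner_row_le μ x f)

/-- The integral operator on `L²` with kernel `K`. -/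
def integralOp (hK : IsUnitKernel K) : Lp ℝ 2 μ →L[ℝ] Lp ℝ 2 μ :=
  LinearMap.mkContinuous
    { toFun := fun f => (hK.memLp_inner_row μ f).toLp
      map_add' := fun f g => by
        rw [← MemLp.toLp_add]
        simp_rw [inner_add_right]
        rfl
      map_smul' := fun c f => by
        rw [RingHom.id_apply, ← MemLp.toLp_const_smul]
        simp_rw [inner_smul_right]
        rfl }
    1 fun f => by
      have h : ∀ᵐ x ∂μ, ‖(hK.memLp_inner_row μ f).toLp _ x‖ ≤ ‖f‖ := by
        filter_upwards [(hK.memLp_inner_row μ f).coeFn_toLp] with x hx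
        rw [hx]
        exact hK.abs_inner_row_le μ x f
      simpa [measureUnivNNReal] using Lp.norm_le_of_ae_bound (norm_nonneg f) h

theorem coeFn_integralOp (hK : IsUnitKernel K) (f : Lp ℝ 2 μ) :
    hK.integralOp μ f =ᵐ[μ] fun x => ⟪hK.row μ x, f⟫_ℝ :=
  (hK.memLp_inner_row μ f).coeFn_toLp

theorem inner_integralOp (hK : IsUnitKernel K) (hL : IsUnitKernel L) (f g : Lp ℝ 2 μ) :
    ⟪hK.integralOp μ f, hL.integralOp μ g⟫_ℝ = ∫ x, ⟪hK.row μ x, f⟫_ℝ * ⟪hL.row μ x, g⟫_ℝ ∂μ := by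
  rw [L2.inner_def]
  refine integral_congr_ae ?_
  filter_upwards [hK.coeFn_integralOp μ f, hL.coeFn_integralOp μ g] with x hf hg
  rw [hf, hg, RCLike.inner_apply, conj_trivial, mul_comm]

/-- Parseval's identity for the Hilbert–Schmidt inner product of two integral operators. -/
theorem hasSum_inner_integralOp {ι : Type*} [Countable ι] (e : HilbertBasis ι ℝ (Lp ℝ 2 μ))
    (hK : IsUnitKernel K) (hL : IsUnitKernel L) :
    HasSum (fun i => ⟪hK.integralOp μ (e i), hL.integralOp μ (e i)⟫_ℝ)
      (∫ x, ∫ y, K x y * L x y ∂μ ∂μ) := by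
  simp_rw [inner_integralOp, ← inner_row_row μ hK hL]
  have hparseval : ∀ {M : α → α → ℝ} (hM : IsUnitKernel M) (x : α),
      HasSum (fun i => ⟪hM.row μ x, e i⟫_ℝ ^ 2) (‖hM.row μ x‖ ^ 2) := fun hM x => by
    simpa only [real_inner_comm (hM.row μ x), ← sq, real_inner_self_eq_norm_sq] using
      e.hasSum_inner_mul_inner (hM.row μ x) (hM.row μ x)
  refine hasSum_integral_of_dominated_convergence
    (fun i x => ⟪hK.row μ x, e i⟫_ℝ ^ 2 + ⟪hL.row μ x, e i⟫_ℝ ^ 2)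
    (fun i => (hK.aestronglyMeasurable_inner_row μ _).mul (hL.aestronglyMeasurable_inner_row μ _))
    (fun i => ae_of_all _ fun x => ?_)
    (ae_of_all _ fun x => ((hparseval hK x).add (hparseval hL x)).summable) ?_
    (ae_of_all _ fun x => ?_)
  · rw [Real.norm_eq_abs, abs_mul]
    nlinarith [sq_nonneg (|⟪hK.row μ x, e i⟫_ℝ| - |⟪hL.row μ x, e i⟫_ℝ|),
      sq_abs ⟪hK.row μ x, e i⟫_ℝ, sq_abs ⟪hL.row μ x, e i⟫_ℝ]
  · have hmeas : ∀ {M : α → α → ℝ} (hM : IsUnitKernel M),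
        AEStronglyMeasurable (fun x => ‖hM.row μ x‖ ^ 2) μ := fun {M} hM => by
      simp_rw [← real_inner_self_eq_norm_sq, inner_row_row]
      have h : StronglyMeasurable (Function.uncurry fun x y => M x y * M x y) :=
        (hM.measurable.mul hM.measurable).stronglyMeasurable
      exact h.integral_prod_right.aestronglyMeasurable
    have hint : ∀ {M : α → α → ℝ} (hM : IsUnitKernel M),
        Integrable (fun x => ‖hM.row μ x‖ ^ 2) μ := fun hM =>
      Integrable.of_bound (hmeas hM) 1 (ae_of_all _ fun x => by
        rw [norm_pow, norm_norm]
        exact pow_le_one₀ (norm_nonneg _) (hM.norm_row_le μ x))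
    simp_rw [((hparseval hK _).add (hparseval hL _)).tsum_eq]
    exact (hint hK).add (hint hL)
  · simpa only [real_inner_comm] using
      e.hasSum_inner_mul_inner (hK.row μ x) (hL.row μ x)

theorem isCompactOperator_integralOp [MeasurableSpace.CountablyGenerated α]
    (hK : IsUnitKernel K) : IsCompactOperator (hK.integralOp μ) := by
  have : Fact ((2 : ENNReal) ≠ ⊤) := ⟨ENNReal.ofNat_ne_top⟩
  obtain ⟨w, e, -⟩ := exists_hilbertBasis ℝ (Lp ℝ 2 μ)
  have : Countable w := e.orthonormal.countable
  refine ContinuousLinearMap.isCompactOperator_of_summable_norm_sq e _ ?_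
  simpa only [real_inner_self_eq_norm_sq] using (hasSum_inner_integralOp μ e hK hK).summable

/-- Fubini's theorem for a kernel between two bounded functions. -/
theorem integral_integral_swap_mul (hK : IsUnitKernel K) {f g : α → ℝ} (hf : Integrable f μ)
    (hg : Integrable g μ) :
    ∫ x, f x * ∫ y, K x y * g y ∂μ ∂μ = ∫ y, (∫ x, f x * K x y ∂μ) * g y ∂μ := by
  have h : Integrable (Function.uncurry fun x y => f x * (K x y * g y)) (μ.prod μ) := by
    refine ((hf.mul_prod hg).bdd_mul (c := 1)
      hK.measurable.aestronglyMeasurable (ae_of_all _ fun p => hK.abs_le p.1 p.2)).congr ?_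
    exact ae_of_all _ fun p => by simp only [Function.uncurry]; ring
  simp_rw [← integral_const_mul, ← integral_mul_const]
  rw [integral_integral_swap h]
  simp_rw [mul_assoc]

theorem isSymmetric_integralOp (hK : IsUnitKernel K) (hsymm : ∀ x y, K x y = K y x) :
    (hK.integralOp μ : Lp ℝ 2 μ →ₗ[ℝ] Lp ℝ 2 μ).IsSymmetric := by
  intro f g
  have hint : ∀ f : Lp ℝ 2 μ, Integrable f μ := fun f => (Lp.memLp f).integrable one_le_two
  have h : ∀ f g : Lp ℝ 2 μ, ⟪f, hK.integralOp μ g⟫_ℝ = ∫ x, f x * ∫ y, K x y * g y ∂μ ∂μ := by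
    intro f g
    rw [L2.inner_def]
    refine integral_congr_ae ?_
    filter_upwards [hK.coeFn_integralOp μ g] with x hx
    rw [hx, inner_row, RCLike.inner_apply, conj_trivial, mul_comm]
  rw [ContinuousLinearMap.coe_coe, real_inner_comm, h, h,
    hK.integral_integral_swap_mul μ (hint f) (hint g)]
  refine integral_congr_ae (ae_of_all _ fun x => ?_)
  simp only [mul_comm, hsymm x]

theorem eigenspace_integralOp (hK : IsUnitKernel K) (c : ℝ) :
    (Module.End.eigenspace (hK.integralOp μ : Lp ℝ 2 μ →ₗ[ℝ] Lp ℝ 2 μ) c : Set (Lp ℝ 2 μ)) =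
      {f | (fun x => ∫ y, K x y * f y ∂μ) =ᵐ[μ] fun x => c * f x} := by
  ext f
  have h₁ := hK.coeFn_integralOp μ f
  simp_rw [inner_row] at h₁
  have h₂ := Lp.coeFn_smul c f
  rw [SetLike.mem_coe, Module.End.mem_eigenspace_iff, ContinuousLinearMap.coe_coe, Lp.ext_iff,
    mem_ofPred_eq]
  exact ⟨fun h => h₁.symm.trans (h.trans h₂), fun h => h₁.trans (h.trans h₂.symm)⟩

end IsUnitKernel

/-- The kernel whose value at `(x, z)` is the density of paths from `x` to `z` with `n` inner
vertices. -/
def pathKernel {α : Type*} [MeasurableSpace α] (μ : Measure α) (K : α → α → ℝ) : ℕ → α → α → ℝ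
  | 0 => K
  | n + 1 => fun x z => ∫ y, K x y * pathKernel μ K n y z ∂μ

theorem MeasureTheory.integral_pi_succ {α : Type*} [MeasurableSpace α] (μ : Measure α)
    [SigmaFinite μ] {n : ℕ} {f : (Fin (n + 1) → α) → ℝ}
    (hf : Integrable f (Measure.pi fun _ => μ)) :
    ∫ v, f v ∂(Measure.pi fun _ => μ) =
      ∫ x, ∫ v : Fin n → α, f (Fin.cons x v) ∂(Measure.pi fun _ => μ) ∂μ := by
  have h := (measurePreserving_piFinSuccAbove (fun _ : Fin (n + 1) => μ) 0).symm
  rw [← h.integral_comp', integral_prod]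
  · simp only [MeasurableEquiv.piFinSuccAbove_symm_apply, Fin.insertNthEquiv_zero]
    rfl
  · exact (h.integrable_comp_emb (MeasurableEquiv.measurableEmbedding _)).2 hf

namespace IsUnitKernel

variable {α : Type*} [MeasurableSpace α] {K : α → α → ℝ} (μ : Measure α) [IsProbabilityMeasure μ]

theorem path (hK : IsUnitKernel K) (n : ℕ) : IsUnitKernel (pathKernel μ K n) := by
  induction n with
  | zero => exact hK
  | succ n ih =>
    constructor
    · have h : StronglyMeasurable (Function.uncurry fun (p : α × α) y =>
          K p.1 y * pathKernel μ K n y p.2) :=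
        ((hK.measurable.comp (measurable_fst.fst.prodMk measurable_snd)).mul
          (ih.measurable.comp (measurable_snd.prodMk measurable_fst.snd))).stronglyMeasurable
      exact h.integral_prod_right.measurable
    · intro x z
      have h := norm_integral_le_of_norm_le_const (μ := μ) (C := 1)
        (f := fun y => K x y * pathKernel μ K n y z) (ae_of_all _ fun y => by
          rw [norm_mul]
          exact mul_le_one₀ (hK.abs_le x y) (norm_nonneg _) (ih.abs_le y z))
      simpa [pathKernel] using h

theorem integrable_prod (hK : IsUnitKernel K) {β ι : Type*} [MeasurableSpace β] [Fintype ι]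
    {ν : Measure β} [IsFiniteMeasure ν] {f g : ι → β → α} (hf : ∀ i, Measurable (f i))
    (hg : ∀ i, Measurable (g i)) : Integrable (fun b => ∏ i, K (f i b) (g i b)) ν := by
  refine Integrable.of_bound (Finset.measurable_fun_prod _ fun i _ =>
    hK.measurable.comp ((hf i).prodMk (hg i))).aestronglyMeasurable 1 (ae_of_all _ fun b => ?_)
  rw [norm_prod]
  exact Finset.prod_le_one (fun i _ => norm_nonneg _) fun i _ => hK.abs_le _ _

theorem integral_prod_cons_snoc (hK : IsUnitKernel K) (n : ℕ) (x z : α) :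
    ∫ v : Fin n → α, ∏ i : Fin (n + 1), K (Fin.cons (α := fun _ => α) x v i)
      (Fin.snoc (α := fun _ => α) v z i) ∂(Measure.pi fun _ => μ) =
      pathKernel μ K n x z := by
  induction n generalizing x with
  | zero => simp [pathKernel, Fin.snoc]
  | succ n ih =>
    rw [integral_pi_succ]
    · refine integral_congr_ae (ae_of_all _ fun y => ?_)
      simp only [← ih, ← integral_const_mul]
      refine integral_congr_ae (ae_of_all _ fun v => ?_)
      simp only
      rw [Fin.prod_univ_succ, ← Fin.cons_snoc_eq_snoc_cons]
      simp
    · refine hK.integrable_prod (fun i => ?_) fun i => ?_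
      · refine Fin.cases ?_ (fun j => ?_) i
        · simp
        · simpa using measurable_pi_apply j
      · refine Fin.lastCases ?_ (fun j => ?_) i
        · simp
        · simpa using measurable_pi_apply j

/-- The density of the cycle of length `n + 2`, as a Hilbert–Schmidt inner product. -/
theorem integral_prod_finRotate (hK : IsUnitKernel K) (hsymm : ∀ x y, K x y = K y x) (n : ℕ) :
    ∫ v : Fin (n + 2) → α, ∏ i, K (v i) (v (finRotate (n + 2) i)) ∂(Measure.pi fun _ => μ) =
      ∫ x, ∫ y, K x y * pathKernel μ K n x y ∂μ ∂μ := by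
  have h : Integrable (Function.uncurry fun x y => K x y * pathKernel μ K n y x)
      (μ.prod μ) := by
    refine Integrable.of_bound (hK.measurable.mul ((hK.path μ n).measurable.comp
      measurable_swap)).aestronglyMeasurable 1 (ae_of_all _ fun p => ?_)
    rw [Function.uncurry, norm_mul]
    exact mul_le_one₀ (hK.abs_le _ _) (norm_nonneg _) ((hK.path μ n).abs_le _ _)
  rw [integral_pi_succ μ (hK.integrable_prod (fun i => measurable_pi_apply i)
    fun i => measurable_pi_apply _)]
  calc _ = ∫ x, pathKernel μ K (n + 1) x x ∂μ := by
        refine integral_congr_ae (ae_of_all _ fun x => ?_)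
        simp only [← hK.integral_prod_cons_snoc μ (n + 1) x x]
        refine integral_congr_ae (ae_of_all _ fun v => Finset.prod_congr rfl fun i _ => ?_)
        congr 1
        refine Fin.lastCases ?_ (fun j => ?_) i
        · simp
        · rw [show finRotate (n + 2) j.castSucc = j.succ from finRotate_of_lt j.2, Fin.snoc_castSucc]
          exact Fin.cons_succ (α := fun _ => α) x v j
    _ = ∫ x, ∫ y, K x y * pathKernel μ K n y x ∂μ ∂μ := rfl
    _ = _ := by
        rw [integral_integral_swap h]
        simp_rw [hsymm]

theorem integralOp_pathKernel (hK : IsUnitKernel K) {c : ℝ} {f : Lp ℝ 2 μ}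
    (hf : hK.integralOp μ f = c • f) (n : ℕ) :
    (hK.path μ n).integralOp μ f = c ^ (n + 1) • f := by
  induction n with
  | zero =>
    rw [zero_add, pow_one]
    exact hf
  | succ n ih =>
    have h : (hK.path μ (n + 1)).integralOp μ f =
        hK.integralOp μ ((hK.path μ n).integralOp μ f) := by
      refine Lp.ext ?_
      filter_upwards [(hK.path μ (n + 1)).coeFn_integralOp μ f,
        hK.coeFn_integralOp μ ((hK.path μ n).integralOp μ f)] with x h₁ h₂
      rw [h₁, h₂, inner_row, inner_row]
      have hint : Integrable (K x) μ := ((hK.memLp_row μ x).integrable one_le_two)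
      rw [pathKernel, ← (hK.path μ n).integral_integral_swap_mul μ hint
        ((Lp.memLp f).integrable one_le_two)]
      refine integral_congr_ae ?_
      filter_upwards [(hK.path μ n).coeFn_integralOp μ f] with y hy
      rw [hy, inner_row]
    rw [h, ih, map_smul, hf, smul_smul, ← pow_succ]

/-- The cycle densities are the power sums of the eigenvalues. -/
theorem exists_hasSum_card_mul_pow [MeasurableSpace.CountablyGenerated α] (hK : IsUnitKernel K)
    (hsymm : ∀ x y, K x y = K y x) :
    ∃ m : ℝ → ℕ, (∀ c ≠ 0, Module.rank ℝ (Module.End.eigenspace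
        (hK.integralOp μ : Lp ℝ 2 μ →ₗ[ℝ] Lp ℝ 2 μ) c) = m c) ∧
      ∀ k ≥ 2, HasSum (fun c => m c * c ^ k)
        (∫ v : Fin k → α, ∏ i, K (v i) (v (finRotate k i)) ∂(Measure.pi fun _ => μ)) := by
  obtain ⟨w, e, he, hw⟩ := ContinuousLinearMap.exists_eigenbasis (hK.isCompactOperator_integralOp μ)
    (hK.isSymmetric_integralOp μ hsymm)
  have : Fact ((2 : ENNReal) ≠ ⊤) := ⟨ENNReal.ofNat_ne_top⟩
  have : Countable (Σ c, w c) := e.orthonormal.countable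
  refine ⟨fun c => Nat.card (w c), fun c hc => (hw c hc).2, fun k hk => ?_⟩
  obtain ⟨n, rfl⟩ := Nat.exists_eq_add_of_le' hk
  have hsum := hasSum_inner_integralOp μ e hK (hK.path μ n)
  rw [← hK.integral_prod_finRotate μ hsymm] at hsum
  simp only [he, hK.integralOp_pathKernel μ (he _), real_inner_smul_left, real_inner_smul_right,
    real_inner_self_eq_norm_sq, e.orthonormal.1, one_pow, mul_one,
    ← pow_succ] at hsum
  refine hsum.sigma fun c => ?_
  rcases eq_or_ne c 0 with rfl | hc
  · simp [hasSum_zero]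
  · have := (hw c hc).1.fintype
    simpa [Nat.card_eq_fintype_card] using hasSum_fintype fun _ : w c => c ^ (n + 2)

end IsUnitKernel

instance : IsProbabilityMeasure μ01 := by
  constructor
  rw [μ01, Measure.restrict_apply_univ]
  simp [Real.volume_Icc]

theorem IsGraphon.isUnitKernel {W : ℝ → ℝ → ℝ} (hW : IsGraphon W) : IsUnitKernel W :=
  ⟨hW.1, fun x y => abs_le.2 ⟨by linarith [(hW.2.2 x y).1], (hW.2.2 x y).2⟩⟩

theorem cycleDensity_eq_integral_pi (W : ℝ → ℝ → ℝ) (k : ℕ) :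
    cycleDensity W k = ∫ v : Fin k → ℝ, ∏ i, W (v i) (v (finRotate k i))
      ∂(Measure.pi fun _ => μ01) := by
  rw [cycleDensity, volume_pi, Measure.restrict_pi_pi]
  rfl

theorem IsGraphon.eigRank_eq {W : ℝ → ℝ → ℝ} (hW : IsGraphon W) (c : ℝ) :
    eigRank W c = Module.rank ℝ (Module.End.eigenspace
      (hW.isUnitKernel.integralOp μ01 : Lp ℝ 2 μ01 →ₗ[ℝ] Lp ℝ 2 μ01) c) := by
  have h : eigSet W c = Module.End.eigenspace
      (hW.isUnitKernel.integralOp μ01 : Lp ℝ 2 μ01 →ₗ[ℝ] Lp ℝ 2 μ01) c :=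
    (hW.isUnitKernel.eigenspace_integralOp μ01 c).symm
  rw [eigRank, h, Submodule.span_eq]

theorem IsGraphon.exists_hasSum_cycleDensity {W : ℝ → ℝ → ℝ} (hW : IsGraphon W) :
    ∃ m : ℝ → ℕ, (∀ c ≠ 0, eigRank W c = m c) ∧
      ∀ k ≥ 2, HasSum (fun c => m c * c ^ k) (cycleDensity W k) := by
  simp_rw [hW.eigRank_eq, cycleDensity_eq_integral_pi]
  exact hW.isUnitKernel.exists_hasSum_card_mul_pow μ01 hW.2.1

end AuxiliaryResults

/-- If cycle densities of `U` and `W` agree for infinitely many odd and infinitely many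
even lengths, then `U` and `W` have the same spectrum including multiplicities. -/
theorem stmt0 (U W : ℝ → ℝ → ℝ) (hU : IsGraphon U) (hW : IsGraphon W)
    (hodd : {k : ℕ | 3 ≤ k ∧ Odd k ∧ cycleDensity U k = cycleDensity W k}.Infinite)
    (heven : {k : ℕ | 3 ≤ k ∧ Even k ∧ cycleDensity U k = cycleDensity W k}.Infinite) :
    ∀ lam : ℝ, lam ≠ 0 → eigRank U lam = eigRank W lam := by
  obtain ⟨m, hm, hmU⟩ := hU.exists_hasSum_cycleDensity
  obtain ⟨n, hn, hnW⟩ := hW.exists_hasSum_cycleDensity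
  have hsub : ∀ k ≥ 2, HasSum (fun c : ℝ => (((m c - n c : ℤ)) : ℝ) * c ^ k)
      (cycleDensity U k - cycleDensity W k) := fun k hk => by
    simpa [sub_mul] using (hmU k hk).sub (hnW k hk)
  intro lam hlam
  have hzero : (m lam - n lam : ℤ) = 0 := by
    refine eq_zero_of_infinite_moments (d := fun c => m c - n c)
      (fun hk => (hsub _ hk).summable) (hodd.mono ?_) (heven.mono ?_) hlam
    all_goals
      rintro k ⟨hk, hparity, heq⟩
      refine ⟨by omega, hparity, ?_⟩
      rw [(hsub k (by omega)).tsum_eq, heq, sub_self]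
  rw [hm lam hlam, hn lam hlam]
  exact_mod_cast sub_eq_zero.1 hzero

end
end

section
/- Let U and W be graphons that have the same spectrum including multiplicities, i.e., for every nonzero real number λ the eigenspaces {f ∈ L²([0,1]) : T_U f = λ f} and {f ∈ L²([0,1]) : T_W f = λ f} have the same (finite) dimension. Then t(C_k, U) = t(C_k, W) for every integer k ≥ 3. -/
open MeasureTheory Set

noncomputable section

section HilbertSpace

variable {H : Type*} [NormedAddCommGroup H] [InnerProductSpace ℝ H]

open scoped InnerProductSpace

/-- An orthonormal family in a separable inner product space is countable. -/
theorem Orthonormal.countable_index [TopologicalSpace.SeparableSpace H] {ι : Type*} {v : ι → H}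
    (hv : Orthonormal ℝ v) : Countable ι := by
  refine Pairwise.countable_of_isOpen_disjoint (s := fun i => Metric.ball (v i) (1 / 2))
    (fun i j hij => Metric.ball_disjoint_ball ?_) (fun _ => Metric.isOpen_ball)
    (fun i => ⟨v i, Metric.mem_ball_self (by norm_num)⟩)
  have h : ‖v i - v j‖ ^ 2 = 2 := by
    rw [norm_sub_sq_real, hv.norm_eq_one, hv.norm_eq_one, hv.inner_eq_zero hij]
    norm_num
  rw [dist_eq_norm]
  nlinarith [norm_nonneg (v i - v j)]

/-- A Hilbert–Schmidt operator is compact. -/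
theorem HilbertBasis.isCompactOperator_of_summable [CompleteSpace H] {ι : Type*}
    (b : HilbertBasis ι ℝ H) (T : H →L[ℝ] H) (hT : Summable fun i => ‖T (b i)‖ ^ 2) :
    IsCompactOperator T := by
  classical
  let S : Finset ι → H →L[ℝ] H :=
    fun F => ∑ i ∈ F, (innerSL ℝ (b i)).smulRight (T (b i))
  have hS : ∀ F f, S F f = ∑ i ∈ F, ⟪b i, f⟫_ℝ • T (b i) := fun F f => by
    simp [S]
  have hlim : ∀ f, Filter.Tendsto (fun F => S F f) Filter.atTop (nhds (T f)) := fun f => by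
    have h := (b.hasSum_repr f).mapL T
    simp only [map_smul, b.repr_apply_apply] at h
    simp only [hS]
    exact h
  have hST : Filter.Tendsto S Filter.atTop (nhds T) := by
    rw [Metric.tendsto_atTop]
    intro ε hε
    obtain ⟨F, hF⟩ := summable_iff_vanishing_norm.1 hT ((ε / 2) ^ 2) (by positivity)
    have key : ∀ G, F ⊆ G → ∀ G', G ⊆ G' → ∀ f, ‖S G' f - S G f‖ ≤ ε / 2 * ‖f‖ := by
      intro G hG G' hG' f
      have h1 : S G' f - S G f = ∑ i ∈ G' \ G, ⟪b i, f⟫_ℝ • T (b i) := by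
        rw [hS, hS, ← Finset.sum_sdiff hG', add_sub_cancel_right]
      have h2 : ∑ i ∈ G' \ G, ‖T (b i)‖ ^ 2 ≤ (ε / 2) ^ 2 := by
        have := hF (G' \ G) (Finset.disjoint_of_subset_right hG Finset.sdiff_disjoint)
        exact (le_abs_self _).trans this.le
      calc ‖S G' f - S G f‖ ≤ ∑ i ∈ G' \ G, ‖⟪b i, f⟫_ℝ‖ * ‖T (b i)‖ := by
            rw [h1]
            refine (norm_sum_le _ _).trans (Finset.sum_le_sum fun i _ => (norm_smul _ _).le)
        _ ≤ √(∑ i ∈ G' \ G, ‖⟪b i, f⟫_ℝ‖ ^ 2) * √(∑ i ∈ G' \ G, ‖T (b i)‖ ^ 2) :=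
            Real.sum_mul_le_sqrt_mul_sqrt _ _ _
        _ ≤ √(‖f‖ ^ 2) * √((ε / 2) ^ 2) := by
            gcongr
            exact b.orthonormal.sum_inner_products_le f
        _ = ε / 2 * ‖f‖ := by
            rw [Real.sqrt_sq (norm_nonneg _), Real.sqrt_sq (by positivity), mul_comm]
    refine ⟨F, fun G hG => ?_⟩
    rw [dist_comm, dist_eq_norm]
    refine lt_of_le_of_lt (ContinuousLinearMap.opNorm_le_bound _ (by positivity) fun f => ?_)
      (half_lt_self hε)
    exact le_of_tendsto ((hlim f).sub_const (S G f)).norm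
      (Filter.eventually_atTop.2 ⟨G, fun G' hG' => key G hG G' hG' f⟩)
  refine isCompactOperator_of_tendsto hST (Filter.Eventually.of_forall fun F => ?_)
  have : FiniteDimensional ℝ (S F).range := by
    have hle : (S F).range ≤ Submodule.span ℝ ((F.image fun i => T (b i) : Finset H) : Set H) := by
      rintro _ ⟨f, rfl⟩
      change S F f ∈ _
      rw [hS]
      exact Submodule.sum_mem _ fun i hi => Submodule.smul_mem _ _
        (Submodule.subset_span (Finset.mem_coe.2 (Finset.mem_image_of_mem _ hi)))
    exact Submodule.finiteDimensional_of_le hle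
  have h := (isCompactOperator_of_locallyCompactSpace_rng
    (T := (S F).range.subtypeL)).comp_clm (S F).rangeRestrict
  exact h

/-- A Hilbert basis of eigenvectors of a compact symmetric operator, grouped by eigenvalue; the
multiplicity of each nonzero eigenvalue is the dimension of its eigenspace. -/
theorem IsCompactOperator.exists_eigenbasis [CompleteSpace H] {T : H →L[ℝ] H}
    (hT : IsCompactOperator T) (hsymm : (T : H →ₗ[ℝ] H).IsSymmetric) :
    ∃ (w : ∀ r, Set (Module.End.eigenspace (T : H →ₗ[ℝ] H) r))
      (b : HilbertBasis (Σ r, w r) ℝ H), (∀ a, T (b a) = a.1 • b a) ∧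
      ∀ r ≠ 0, Nat.card (w r) =
        Module.finrank ℝ (Module.End.eigenspace (T : H →ₗ[ℝ] H) r) := by
  have hclosed : ∀ r, IsClosed (Module.End.eigenspace (T : H →ₗ[ℝ] H) r : Set H) := fun r => by
    have : (Module.End.eigenspace (T : H →ₗ[ℝ] H) r : Set H) = {x | T x = r • x} := by
      ext x
      exact Module.End.mem_eigenspace_iff
    rw [this]
    exact isClosed_eq T.continuous (continuous_const_smul r)
  have hcomplete : ∀ r, CompleteSpace (Module.End.eigenspace (T : H →ₗ[ℝ] H) r) :=
    fun r => (hclosed r).completeSpace_coe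
  choose w c hc using fun r => exists_hilbertBasis ℝ (Module.End.eigenspace (T : H →ₗ[ℝ] H) r)
  have hortho := hsymm.orthogonalFamily_eigenspaces.orthonormal_sigma_orthonormal
    (fun r => (c r).orthonormal)
  have hperp : (Submodule.span ℝ (Set.range fun a : Σ r, w r =>
      (Module.End.eigenspace (T : H →ₗ[ℝ] H) a.1).subtypeₗᵢ (c a.1 a.2)))ᗮ = ⊥ := by
    rw [eq_bot_iff, ← ContinuousLinearMap.orthogonalComplement_iSup_eigenspaces_eq_bot hT hsymm,
      ← Submodule.orthogonal_closure]
    refine Submodule.orthogonal_le (iSup_le fun r x hx => ?_)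
    have hsum := ((c r).hasSum_repr ⟨x, hx⟩).mapL
      (Module.End.eigenspace (T : H →ₗ[ℝ] H) r).subtypeL
    refine (Submodule.isClosed_topologicalClosure _).mem_of_tendsto hsum
      (Filter.Eventually.of_forall fun F => Submodule.le_topologicalClosure _ ?_)
    refine Submodule.sum_mem _ fun i _ => ?_
    rw [map_smul]
    exact Submodule.smul_mem _ _ (Submodule.subset_span ⟨⟨r, i⟩, rfl⟩)
  refine ⟨w, HilbertBasis.mkOfOrthogonalEqBot hortho hperp, fun a => ?_, fun r hr => ?_⟩
  · rw [HilbertBasis.coe_mkOfOrthogonalEqBot]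
    exact Module.End.mem_eigenspace_iff.1 (c a.1 a.2).2
  · have := ContinuousLinearMap.finite_dimensional_eigenspace hT r hr
    have hfin := (c r).orthonormal.linearIndependent.finite
    have := Fintype.ofFinite (w r)
    rw [Module.finrank_eq_card_basis (c r).toOrthonormalBasis.toBasis, Nat.card_eq_fintype_card]

end HilbertSpace

section Kernel

open scoped InnerProductSpace

variable {α : Type*} [MeasurableSpace α] {μ : Measure α} [IsProbabilityMeasure μ]
  {K L W G : α → α → ℝ}

/-- A measurable kernel bounded by `1` in absolute value. -/
structure IsBddKernel (K : α → α → ℝ) : Prop where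
  measurable : Measurable (Function.uncurry K)
  abs_le : ∀ x y, |K x y| ≤ 1

/-- Composition of kernels. -/
def kernelComp (μ : Measure α) (K L : α → α → ℝ) : α → α → ℝ := fun x y => ∫ z, K x z * L z y ∂μ

namespace IsBddKernel

theorem measurable_row (hK : IsBddKernel K) (x : α) : Measurable (K x) :=
  hK.measurable.comp measurable_prodMk_left

theorem memLp_row (hK : IsBddKernel K) (x : α) : MemLp (K x) 2 μ :=
  MemLp.of_bound (hK.measurable_row x).aestronglyMeasurable 1
    (Filter.Eventually.of_forall fun y => hK.abs_le x y)

/-- The function `K x` as an element of `L²`. -/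
def row (μ : Measure α) [IsProbabilityMeasure μ] (hK : IsBddKernel K) (x : α) : Lp ℝ 2 μ :=
  (hK.memLp_row x).toLp

theorem norm_row_le (hK : IsBddKernel K) (x : α) : ‖hK.row μ x‖ ≤ 1 := by
  have h := Lp.norm_le_of_ae_bound (f := hK.row μ x) zero_le_one (by
    filter_upwards [(hK.memLp_row (μ := μ) x).coeFn_toLp] with y hy
    rw [row, hy]
    exact hK.abs_le x y)
  simpa [measureUnivNNReal] using h

theorem inner_row (hK : IsBddKernel K) (x : α) (f : Lp ℝ 2 μ) :
    ⟪hK.row μ x, f⟫_ℝ = ∫ y, K x y * f y ∂μ := by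
  rw [L2.inner_def]
  refine integral_congr_ae ?_
  filter_upwards [(hK.memLp_row (μ := μ) x).coeFn_toLp] with y hy
  rw [row, hy, real_inner_comm]
  rfl

theorem stronglyMeasurable_inner_row (hK : IsBddKernel K) (f : Lp ℝ 2 μ) :
    StronglyMeasurable fun x => ⟪hK.row μ x, f⟫_ℝ := by
  simp only [hK.inner_row]
  exact StronglyMeasurable.integral_prod_right' (f := fun p : α × α => K p.1 p.2 * f p.2)
    (hK.measurable.stronglyMeasurable.mul
      ((Lp.stronglyMeasurable f).comp_measurable measurable_snd))

theorem memLp_inner_row (hK : IsBddKernel K) (f : Lp ℝ 2 μ) :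
    MemLp (fun x => ⟪hK.row μ x, f⟫_ℝ) 2 μ :=
  MemLp.of_bound (hK.stronglyMeasurable_inner_row f).aestronglyMeasurable ‖f‖
    (Filter.Eventually.of_forall fun x => (norm_inner_le_norm _ _).trans
      (mul_le_of_le_one_left (norm_nonneg _) (hK.norm_row_le x)))

/-- The integral operator on `L²` with kernel `K`. -/
def op (μ : Measure α) [IsProbabilityMeasure μ] (hK : IsBddKernel K) :
    Lp ℝ 2 μ →L[ℝ] Lp ℝ 2 μ :=
  LinearMap.mkContinuous
    { toFun := fun f => (hK.memLp_inner_row f).toLp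
      map_add' := fun f g => by
        rw [← MemLp.toLp_add]
        exact MemLp.toLp_congr _ _ (Filter.Eventually.of_forall fun x => inner_add_right _ _ _)
      map_smul' := fun c f => by
        rw [RingHom.id_apply, ← MemLp.toLp_const_smul]
        exact MemLp.toLp_congr _ _
          (Filter.Eventually.of_forall fun x => real_inner_smul_right _ _ _) }
    1 fun f => by
      have h := Lp.norm_le_of_ae_bound (f := (hK.memLp_inner_row f).toLp) (norm_nonneg f) (by
        filter_upwards [(hK.memLp_inner_row f).coeFn_toLp] with x hx
        rw [hx]
        exact (norm_inner_le_norm _ _).trans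
          (mul_le_of_le_one_left (norm_nonneg _) (hK.norm_row_le x)))
      simpa [measureUnivNNReal] using h

theorem coeFn_op' (hK : IsBddKernel K) (f : Lp ℝ 2 μ) :
    hK.op μ f =ᵐ[μ] fun x => ⟪hK.row μ x, f⟫_ℝ :=
  (hK.memLp_inner_row f).coeFn_toLp

theorem coeFn_op (hK : IsBddKernel K) (f : Lp ℝ 2 μ) :
    hK.op μ f =ᵐ[μ] fun x => ∫ y, K x y * f y ∂μ := by
  simpa only [hK.inner_row] using hK.coeFn_op' f

protected theorem comp (hK : IsBddKernel K) (hL : IsBddKernel L) :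
    IsBddKernel (kernelComp μ K L) where
  measurable := by
    have h : Measurable fun q : (α × α) × α => K q.1.1 q.2 * L q.2 q.1.2 :=
      (hK.measurable.comp (measurable_fst.fst.prodMk measurable_snd)).mul
        (hL.measurable.comp (measurable_snd.prodMk measurable_fst.snd))
    exact (h.stronglyMeasurable.integral_prod_right' (ν := μ)).measurable
  abs_le x y := by
    have h := norm_integral_le_of_norm_le_const (μ := μ) (f := fun z => K x z * L z y) (C := 1)
      (Filter.Eventually.of_forall fun z => by
        rw [norm_mul]
        exact mul_le_one₀ (hK.abs_le x z) (norm_nonneg _) (hL.abs_le z y))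
    simpa [kernelComp] using h

theorem iterate_comp (hK : IsBddKernel K) (hL : IsBddKernel L) (n : ℕ) :
    IsBddKernel ((kernelComp μ K)^[n] L) := by
  induction n with
  | zero => exact hL
  | succ n ih =>
    rw [Function.iterate_succ_apply']
    exact hK.comp ih

theorem op_comp (hK : IsBddKernel K) (hL : IsBddKernel L) (f : Lp ℝ 2 μ) :
    (hK.comp (μ := μ) hL).op μ f = hK.op μ (hL.op μ f) := by
  refine Lp.ext ?_
  filter_upwards [(hK.comp (μ := μ) hL).coeFn_op f, hK.coeFn_op (hL.op μ f)] with x h1 h2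
  rw [h1, h2]
  have hint : Integrable (Function.uncurry fun y z => K x z * L z y * f y) (μ.prod μ) := by
    refine (((Lp.memLp f).integrable one_le_two).comp_fst μ).bdd_mul (c := 1)
      (f := fun p : α × α => K x p.2 * L p.2 p.1) ?_
      (Filter.Eventually.of_forall fun p => ?_)
    · exact (((hK.measurable_row x).comp measurable_snd).mul
        (hL.measurable.comp measurable_swap)).aestronglyMeasurable
    · rw [norm_mul]
      exact mul_le_one₀ (hK.abs_le _ _) (norm_nonneg _) (hL.abs_le _ _)
  calc ∫ y, kernelComp μ K L x y * f y ∂μ = ∫ y, ∫ z, K x z * L z y * f y ∂μ ∂μ := by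
        simp only [kernelComp, integral_mul_const]
    _ = ∫ z, ∫ y, K x z * L z y * f y ∂μ ∂μ := integral_integral_swap hint
    _ = ∫ z, K x z * (hL.op μ f) z ∂μ := by
        refine integral_congr_ae ?_
        filter_upwards [hL.coeFn_op f] with z hz
        simp only [hz, mul_assoc, integral_const_mul]

theorem isSymmetric_op (hK : IsBddKernel K) (hsymm : ∀ x y, K x y = K y x) :
    (hK.op μ : Lp ℝ 2 μ →ₗ[ℝ] Lp ℝ 2 μ).IsSymmetric := by
  intro f g
  have hint : Integrable (Function.uncurry fun x y => K x y * (f y * g x)) (μ.prod μ) := by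
    refine Integrable.bdd_mul (c := 1) (f := Function.uncurry K) ?_
      hK.measurable.aestronglyMeasurable (Filter.Eventually.of_forall fun p => hK.abs_le _ _)
    have h := ((Lp.memLp g).integrable one_le_two).mul_prod ((Lp.memLp f).integrable one_le_two)
    simpa only [mul_comm] using h
  calc ⟪hK.op μ f, g⟫_ℝ = ∫ x, ∫ y, K x y * (f y * g x) ∂μ ∂μ := by
        rw [L2.inner_def]
        refine integral_congr_ae ?_
        filter_upwards [hK.coeFn_op f] with x hx
        simp only [hx, ← mul_assoc, integral_mul_const]
        exact mul_comm _ _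
    _ = ∫ y, ∫ x, K x y * (f y * g x) ∂μ ∂μ := integral_integral_swap hint
    _ = ⟪f, hK.op μ g⟫_ℝ := by
        rw [L2.inner_def]
        refine integral_congr_ae ?_
        filter_upwards [hK.coeFn_op g] with y hy
        simp only [hy, hsymm _ y, mul_left_comm _ (f y), integral_const_mul]
        exact mul_comm _ _

/-- The Hilbert–Schmidt inner product of two integral operators, computed in a Hilbert basis. -/
theorem hasSum_inner_op [TopologicalSpace.SeparableSpace (Lp ℝ 2 μ)] (hK : IsBddKernel K)
    (hL : IsBddKernel L) {ι : Type*} (b : HilbertBasis ι ℝ (Lp ℝ 2 μ)) :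
    HasSum (fun i => ⟪hK.op μ (b i), hL.op μ (b i)⟫_ℝ) (∫ x, ∫ y, K x y * L x y ∂μ ∂μ) := by
  have : Countable ι := b.orthonormal.countable_index
  let F : ι → α → ℝ := fun i x => ⟪hK.row μ x, b i⟫_ℝ * ⟪b i, hL.row μ x⟫_ℝ
  have hbd : ∀ i x, ‖⟪hK.row μ x, b i⟫_ℝ‖ ≤ 1 := fun i x =>
    (norm_inner_le_norm _ _).trans (by
      rw [b.orthonormal.norm_eq_one, mul_one]
      exact hK.norm_row_le x)
  have hFint : ∀ i, Integrable (F i) μ := fun i => by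
    simp only [F, real_inner_comm (hL.row μ _)]
    exact ((hL.memLp_inner_row (b i)).integrable one_le_two).bdd_mul (c := 1)
      (hK.stronglyMeasurable_inner_row (b i)).aestronglyMeasurable
      (Filter.Eventually.of_forall fun x => hbd i x)
  have hFsum : Summable fun i => ∫ x, ‖F i x‖ ∂μ := by
    refine summable_of_sum_le (c := 1) (fun i => integral_nonneg fun x => norm_nonneg _)
      fun s => ?_
    rw [← integral_finsetSum _ fun i _ => (hFint i).norm]
    have hle : ∀ x, ∑ i ∈ s, ‖F i x‖ ≤ 1 := fun x => by
      have hK1 : ∑ i ∈ s, ‖⟪hK.row μ x, b i⟫_ℝ‖ ^ 2 ≤ 1 := by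
        simp only [real_inner_comm (b _)]
        refine (b.orthonormal.sum_inner_products_le _).trans ?_
        exact pow_le_one₀ (norm_nonneg _) (hK.norm_row_le x)
      have hL1 : ∑ i ∈ s, ‖⟪b i, hL.row μ x⟫_ℝ‖ ^ 2 ≤ 1 :=
        (b.orthonormal.sum_inner_products_le _).trans
          (pow_le_one₀ (norm_nonneg _) (hL.norm_row_le x))
      simp only [F, norm_mul]
      refine (Real.sum_mul_le_sqrt_mul_sqrt _ _ _).trans ?_
      exact mul_le_one₀ (Real.sqrt_le_one.2 hK1) (Real.sqrt_nonneg _) (Real.sqrt_le_one.2 hL1)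
    refine (integral_mono (integrable_finsetSum _ fun i _ => (hFint i).norm)
      (integrable_const 1) hle).trans ?_
    simp
  convert! hasSum_integral_of_summable_integral_norm hFint hFsum using 1
  · ext i
    rw [L2.inner_def]
    refine integral_congr_ae ?_
    filter_upwards [hK.coeFn_op' (b i), hL.coeFn_op' (b i)] with x h1 h2
    rw [h1, h2]
    simp only [F, real_inner_comm (hL.row μ _)]
    exact mul_comm _ _
  · refine integral_congr_ae (Filter.Eventually.of_forall fun x => ?_)
    simp only [F]
    rw [(b.hasSum_inner_mul_inner _ _).tsum_eq, hK.inner_row]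
    refine integral_congr_ae ?_
    filter_upwards [(hL.memLp_row (μ := μ) x).coeFn_toLp] with y hy
    rw [row, hy]

theorem isCompactOperator_op [TopologicalSpace.SeparableSpace (Lp ℝ 2 μ)] (hK : IsBddKernel K) :
    IsCompactOperator (hK.op μ) := by
  obtain ⟨w, b, -⟩ := exists_hilbertBasis ℝ (Lp ℝ 2 μ)
  refine b.isCompactOperator_of_summable _ ?_
  simpa only [real_inner_self_eq_norm_sq] using (hK.hasSum_inner_op hK b).summable

theorem op_iterate_comp_apply (hW : IsBddKernel W) {f : Lp ℝ 2 μ} {r : ℝ}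
    (hf : hW.op μ f = r • f) (n : ℕ) :
    (hW.iterate_comp (μ := μ) hW n).op μ f = r ^ (n + 1) • f := by
  induction n with
  | zero => simpa using hf
  | succ n ih =>
    have h : (hW.iterate_comp (μ := μ) hW (n + 1)).op μ f
        = (hW.comp (μ := μ) (hW.iterate_comp (μ := μ) hW n)).op μ f := by
      congr 2
      exact Function.iterate_succ_apply' _ _ _
    rw [h, hW.op_comp (hW.iterate_comp hW n), ih, map_smul, hf, smul_smul, ← pow_succ]

/-- Integrating a product of kernels along a path amounts to composing the kernels. -/
theorem integral_path (hW : IsBddKernel W) (hG : IsBddKernel G) (m : ℕ) :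
    ∫ x : Fin (m + 1) → α, (∏ i : Fin m, W (x i.castSucc) (x i.succ)) * G (x (Fin.last m)) (x 0)
      ∂(Measure.pi fun _ => μ) = ∫ x, (kernelComp μ W)^[m] G x x ∂μ := by
  induction m generalizing G with
  | zero =>
    have h := (measurePreserving_funUnique μ (Fin 1)).integral_comp' (fun x => G x x)
    simp only [Finset.univ_eq_empty, Finset.prod_empty, one_mul, Function.iterate_zero, id_eq]
    convert! h using 1
  | succ m ih =>
    let P : (Fin (m + 1) → α) → ℝ := fun x => ∏ i : Fin m, W (x i.castSucc) (x i.succ)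
    have hPmeas : Measurable P := Finset.measurable_prod _ fun i _ =>
      hW.measurable.comp (g := Function.uncurry W)
        (f := fun x : Fin (m + 1) → α => (x i.castSucc, x i.succ))
        ((measurable_pi_apply _).prodMk (measurable_pi_apply _))
    have hPle : ∀ x, ‖P x‖ ≤ 1 := fun x => by
      rw [norm_prod]
      exact Finset.prod_le_one (fun _ _ => norm_nonneg _) fun _ _ => hW.abs_le _ _
    let e := MeasurableEquiv.piFinSuccAbove (fun _ => α) (Fin.last (m + 1))
    have he : MeasurePreserving e.symm (μ.prod (Measure.pi fun _ => μ)) (Measure.pi fun _ => μ) :=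
      (measurePreserving_piFinSuccAbove (fun _ => μ) (Fin.last (m + 1))).symm
    have hsplit : ∀ p : α × (Fin (m + 1) → α),
        (∏ i : Fin (m + 1), W (e.symm p i.castSucc) (e.symm p i.succ)) *
          G (e.symm p (Fin.last (m + 1))) (e.symm p 0) =
        P p.2 * (W (p.2 (Fin.last m)) p.1 * G p.1 (p.2 0)) := fun p => by
      have hcast : ∀ i, e.symm p (Fin.castSucc i) = p.2 i := fun i => by
        simp [e, MeasurableEquiv.piFinSuccAbove_symm_apply]
      have hlast : e.symm p (Fin.last (m + 1)) = p.1 := by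
        simp [e, MeasurableEquiv.piFinSuccAbove_symm_apply]
      rw [Fin.prod_univ_castSucc, Fin.succ_last, hlast, ← Fin.castSucc_zero]
      simp only [Fin.succ_castSucc, hcast, P, mul_assoc]
    have hint : Integrable (fun p : α × (Fin (m + 1) → α) =>
        P p.2 * (W (p.2 (Fin.last m)) p.1 * G p.1 (p.2 0))) (μ.prod (Measure.pi fun _ => μ)) := by
      refine Integrable.of_bound (C := 1) (Measurable.aestronglyMeasurable ?_)
        (Filter.Eventually.of_forall fun p => ?_)
      · have h0 : ∀ i, Measurable fun p : α × (Fin (m + 1) → α) => p.2 i := fun i =>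
          (measurable_pi_apply i).comp measurable_snd
        exact (hPmeas.comp measurable_snd).mul
          ((hW.measurable.comp ((h0 _).prodMk measurable_fst)).mul
            (hG.measurable.comp (measurable_fst.prodMk (h0 _))))
      · rw [norm_mul, norm_mul]
        exact mul_le_one₀ (hPle _) (by positivity)
          (mul_le_one₀ (hW.abs_le _ _) (norm_nonneg _) (hG.abs_le _ _))
    rw [Function.iterate_succ_apply, ← ih (hW.comp (μ := μ) hG), ← he.integral_comp']
    simp only [hsplit]
    rw [integral_prod_symm _ hint]
    simp only [integral_const_mul, P, kernelComp]

/-- The density of the `(n + 2)`-cycle is the sum of the `(n + 2)`-th powers of the nonzero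
eigenvalues, counted with multiplicity. -/
theorem integral_iterate_comp_eq_tsum [TopologicalSpace.SeparableSpace (Lp ℝ 2 μ)]
    (hW : IsBddKernel W) (hsymm : ∀ x y, W x y = W y x) (n : ℕ) :
    ∫ x, (kernelComp μ W)^[n + 1] W x x ∂μ = ∑' r : ℝ,
      Module.finrank ℝ (Module.End.eigenspace (hW.op μ : Lp ℝ 2 μ →ₗ[ℝ] Lp ℝ 2 μ) r) *
        r ^ (n + 2) := by
  have hWn := hW.iterate_comp (μ := μ) hW n
  obtain ⟨w, b, hb, hw⟩ := hW.isCompactOperator_op.exists_eigenbasis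
    (hW.isSymmetric_op (μ := μ) hsymm)
  have hsum := hW.hasSum_inner_op hWn b
  have hterm : ∀ a, ⟪hW.op μ (b a), hWn.op μ (b a)⟫_ℝ = a.1 ^ (n + 2) := fun a => by
    rw [hb, hW.op_iterate_comp_apply (hb a), real_inner_smul_left, real_inner_smul_right,
      real_inner_self_eq_norm_sq, b.orthonormal.norm_eq_one]
    ring
  simp only [hterm] at hsum
  have hint : Integrable
      (Function.uncurry fun x y => W x y * (kernelComp μ W)^[n] W x y) (μ.prod μ) :=
    Integrable.of_bound (C := 1) (hW.measurable.mul hWn.measurable).aestronglyMeasurable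
      (Filter.Eventually.of_forall fun p => by
        rw [Function.uncurry, norm_mul]
        exact mul_le_one₀ (hW.abs_le _ _) (norm_nonneg _) (hWn.abs_le _ _))
  calc ∫ x, (kernelComp μ W)^[n + 1] W x x ∂μ
      = ∫ y, ∫ x, W x y * (kernelComp μ W)^[n] W x y ∂μ ∂μ := by
        simp only [Function.iterate_succ_apply']
        simp only [kernelComp, hsymm _]
    _ = ∑' a : Σ r, w r, a.1 ^ (n + 2) := by
        rw [← integral_integral_swap hint, hsum.tsum_eq]
    _ = _ := by
        rw [hsum.summable.tsum_sigma]
        refine tsum_congr fun r => ?_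
        simp only [tsum_const, nsmul_eq_mul]
        rcases eq_or_ne r 0 with rfl | hr
        · simp
        · rw [hw r hr]

end IsBddKernel

end Kernel

theorem isProbabilityMeasure_μ01 : IsProbabilityMeasure μ01 :=
  ⟨by simp [μ01, Real.volume_Icc]⟩

namespace IsGraphon

variable {W : ℝ → ℝ → ℝ}

theorem isBddKernel (hW : IsGraphon W) : IsBddKernel W where
  measurable := hW.1
  abs_le x y := abs_le.2 ⟨by linarith [(hW.2.2 x y).1], (hW.2.2 x y).2⟩

theorem eigRank_eq_s1 [IsProbabilityMeasure μ01] (hW : IsGraphon W) (r : ℝ) :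
    eigRank W r = Module.rank ℝ (Module.End.eigenspace
      (hW.isBddKernel.op μ01 : Lp ℝ 2 μ01 →ₗ[ℝ] Lp ℝ 2 μ01) r) := by
  have h : eigSet W r = Module.End.eigenspace
      (hW.isBddKernel.op μ01 : Lp ℝ 2 μ01 →ₗ[ℝ] Lp ℝ 2 μ01) r := by
    ext f
    rw [SetLike.mem_coe, Module.End.mem_eigenspace_iff]
    have h1 := hW.isBddKernel.coeFn_op f
    have h2 := Lp.coeFn_smul r f
    exact ⟨fun hf => Lp.ext (h1.trans (Filter.EventuallyEq.trans hf h2.symm)), fun hf =>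
      h1.symm.trans (Filter.EventuallyEq.trans (by rw [← hf]; rfl) h2)⟩
  rw [eigRank, h, Submodule.span_eq]

theorem cycleDensity_eq_tsum (hW : IsGraphon W) (n : ℕ) :
    cycleDensity W (n + 2) = ∑' r : ℝ, (eigRank W r).toNat * r ^ (n + 2) := by
  have := isProbabilityMeasure_μ01
  have : Fact ((2 : ENNReal) ≠ ⊤) := ⟨ENNReal.ofNat_ne_top⟩
  simp only [hW.eigRank_eq_s1]
  refine Eq.trans ?_ (hW.isBddKernel.integral_iterate_comp_eq_tsum hW.2.1 n)
  rw [← hW.isBddKernel.integral_path hW.isBddKernel, cycleDensity, volume_pi,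
    Measure.restrict_pi_pi]
  refine integral_congr_ae (Filter.Eventually.of_forall fun x => ?_)
  simp only [Fin.prod_univ_castSucc (n := n + 1), finRotate_apply, Fin.coeSucc_eq_succ, Fin.last_add_one]

end IsGraphon

/-- If `U` and `W` have the same spectrum including multiplicities, then all cycle
densities agree. -/
theorem stmt1 (U W : ℝ → ℝ → ℝ) (hU : IsGraphon U) (hW : IsGraphon W)
    (hspec : ∀ lam : ℝ, lam ≠ 0 → eigRank U lam = eigRank W lam) :
    ∀ k : ℕ, 3 ≤ k → cycleDensity U k = cycleDensity W k := by
  intro k hk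
  obtain ⟨n, rfl⟩ := Nat.exists_eq_add_of_le' (le_trans (by norm_num : 2 ≤ 3) hk)
  rw [hU.cycleDensity_eq_tsum, hW.cycleDensity_eq_tsum]
  refine tsum_congr fun r => ?_
  rcases eq_or_ne r 0 with rfl | hr
  · simp
  · rw [hspec r hr]

end
end

section
/- Let U and W be graphons with ‖U‖₁ > ‖W‖₁, where ‖·‖₁ denotes the L¹-norm on [0,1]². Suppose U' and W' are two {0,1}-valued graphons with δ_□(U, U') < (‖U‖₁ − ‖W‖₁)/2 and δ_□(W, W') < (‖U‖₁ − ‖W‖₁)/2. Then U' and W' are not cospectral; that is, there exists an integer k ≥ 3 with t(C_k, U') ≠ t(C_k, W'). -/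
open MeasureTheory Set

noncomputable section

section abstractForm
variable {V : Type*} [AddCommGroup V] [Module ℝ V]

/-- For a self-adjoint contraction `T` of a positive semidefinite form, the powers of `1 - T²`
tend to zero on the closure of the range of `T`. -/
lemma tendsto_one_sub_sq_pow (b : V →ₗ[ℝ] V →ₗ[ℝ] ℝ) (hsymm : ∀ x y, b x y = b y x)
    (hpos : ∀ x, 0 ≤ b x x) (T : Module.End ℝ V) (hT : ∀ x y, b (T x) y = b x (T y))
    (hc : ∀ x, b (T x) (T x) ≤ b x x) (u : V)
    (hu : ∀ ε > 0, ∃ k, b (u - T k) (u - T k) < ε) :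
    Filter.Tendsto (fun m : ℕ => b (((1 - T * T) ^ m) u) (((1 - T * T) ^ m) u)) Filter.atTop
      (nhds 0) := by
  set B : Module.End ℝ V := 1 - T * T with hB
  have hBapp (v : V) : B v = v - T (T v) := by simp [hB]
  have hsq (v : V) : b (B v) (B v) = b v v - 2 * b (T v) (T v) + b (T (T v)) (T (T v)) := by
    rw [hBapp]
    simp only [map_sub, LinearMap.sub_apply]
    rw [hsymm v (T (T v)), hT (T v) v]
    ring
  have hBc (v : V) : b (B v) (B v) ≤ b v v - b (T v) (T v) := by
    linarith [hsq v, hc (T v)]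
  have hBc' (v : V) : b (B v) (B v) ≤ b v v := by linarith [hBc v, hpos (T v)]
  have hcontr (m : ℕ) (v : V) : b ((B ^ m) v) ((B ^ m) v) ≤ b v v := by
    induction m with
    | zero => simp
    | succ m ih =>
      rw [pow_succ', Module.End.mul_apply]
      exact (hBc' _).trans ih
  have hcommT : Commute B T := by
    rw [hB]; exact (Commute.one_left T).sub_left ((Commute.refl T).mul_left (Commute.refl T))
  have hcomm (m : ℕ) (v : V) : (B ^ m) (T v) = T ((B ^ m) v) := by
    rw [← Module.End.mul_apply, ← Module.End.mul_apply, (hcommT.pow_left m).eq]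
  have hrate (k : V) (m : ℕ) :
      m * b ((B ^ m) (T k)) ((B ^ m) (T k)) + b ((B ^ m) k) ((B ^ m) k) ≤ b k k := by
    induction m with
    | zero => simp
    | succ m ih =>
      have h1 : b ((B ^ (m + 1)) (T k)) ((B ^ (m + 1)) (T k)) ≤
          b ((B ^ m) (T k)) ((B ^ m) (T k)) := by
        rw [pow_succ', Module.End.mul_apply]; exact hBc' _
      have h2 : b ((B ^ (m + 1)) k) ((B ^ (m + 1)) k) ≤ b ((B ^ m) k) ((B ^ m) k) -
          b ((B ^ m) (T k)) ((B ^ m) (T k)) := by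
        rw [pow_succ', Module.End.mul_apply, hcomm]; exact hBc _
      push_cast
      nlinarith [mul_le_mul_of_nonneg_left h1 (by positivity : (0 : ℝ) ≤ m + 1)]
  rw [Metric.tendsto_atTop]
  intro ε hε
  obtain ⟨k, hk⟩ := hu (ε / 4) (by positivity)
  obtain ⟨N, hN⟩ := exists_nat_gt (4 * b k k / ε)
  refine ⟨N, fun m hm => ?_⟩
  rw [Real.dist_0_eq_abs, abs_of_nonneg (hpos _)]
  have hr : b ((B ^ m) (T k)) ((B ^ m) (T k)) < ε / 4 := by
    by_contra! hcon
    have h1 : 4 * b k k / ε < m := hN.trans_le (by exact_mod_cast hm)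
    rw [div_lt_iff₀ hε] at h1
    nlinarith [hrate k m, hpos ((B ^ m) k),
      mul_le_mul_of_nonneg_left hcon (by positivity : (0 : ℝ) ≤ m)]
  have hs := (hcontr m (u - T k)).trans_lt hk
  have key (x y : V) : b (x + y) (x + y) ≤ 2 * b x x + 2 * b y y := by
    have := hpos (x - y)
    simp only [map_sub, map_add, LinearMap.sub_apply, LinearMap.add_apply] at this ⊢
    linarith
  have h3 := key ((B ^ m) (u - T k)) ((B ^ m) (T k))
  rw [← map_add, sub_add_cancel] at h3
  linarith

lemma form_one_sub_sq_pow_apply (b : V →ₗ[ℝ] V →ₗ[ℝ] ℝ) (T : Module.End ℝ V)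
    (hT : ∀ x y, b (T x) y = b x (T y)) (m : ℕ) (x y : V) :
    b (((1 - T * T) ^ m) x) y = b x (((1 - T * T) ^ m) y) := by
  induction m generalizing x y with
  | zero => simp
  | succ m ih =>
    rw [pow_succ, Module.End.mul_apply, ih, ← pow_succ, pow_succ', Module.End.mul_apply]
    simp [hT]

/-- If two self-adjoint operators have equal moments of positive order at two vectors on which
the powers of `1 - T²` tend to zero, then the two vectors have equal norms. -/
lemma form_self_eq_of_moments_eq (b : V →ₗ[ℝ] V →ₗ[ℝ] ℝ) (T S : Module.End ℝ V)
    (hT : ∀ x y, b (T x) y = b x (T y)) (hS : ∀ x y, b (S x) y = b x (S y)) (u w : V)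
    (hu : Filter.Tendsto (fun m : ℕ => b (((1 - T * T) ^ m) u) (((1 - T * T) ^ m) u)) Filter.atTop
      (nhds 0))
    (hw : Filter.Tendsto (fun m : ℕ => b (((1 - S * S) ^ m) w) (((1 - S * S) ^ m) w)) Filter.atTop
      (nhds 0))
    (hmom : ∀ k, b ((T ^ (k + 1)) u) u = b ((S ^ (k + 1)) w) w) :
    b u u = b w w := by
  have hstep (R : Module.End ℝ V) (m k : ℕ) :
      (1 - R * R) ^ (m + 1) * R ^ k = (1 - R * R) ^ m * R ^ k - (1 - R * R) ^ m * R ^ (k + 2) := by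
    rw [pow_succ, mul_assoc, sub_mul, one_mul, mul_sub, ← pow_two, ← pow_add, add_comm 2 k]
  have hD (m k : ℕ) : b (((1 - T * T) ^ m * T ^ k) u) u - b (((1 - S * S) ^ m * S ^ k) w) w
      = if k = 0 then b u u - b w w else 0 := by
    induction m generalizing k with
    | zero =>
      cases k with
      | zero => simp
      | succ k => simpa [sub_eq_zero] using hmom k
    | succ m ih =>
      rw [hstep, hstep, LinearMap.sub_apply, LinearMap.sub_apply, map_sub, map_sub,
        LinearMap.sub_apply, LinearMap.sub_apply]
      have h1 := ih k
      have h2 := ih (k + 2)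
      rw [if_neg (by omega)] at h2
      linarith
  have hconst (m : ℕ) : b (((1 - T * T) ^ m) u) (((1 - T * T) ^ m) u) -
      b (((1 - S * S) ^ m) w) (((1 - S * S) ^ m) w) = b u u - b w w := by
    have := hD (m + m) 0
    rw [pow_zero, mul_one, pow_zero, mul_one, pow_add, pow_add, Module.End.mul_apply,
      Module.End.mul_apply, form_one_sub_sq_pow_apply b T hT, form_one_sub_sq_pow_apply b S hS,
      if_pos rfl] at this
    exact this
  have hlim := hu.sub hw
  simp only [hconst, sub_zero] at hlim
  exact sub_eq_zero.mp (tendsto_nhds_unique tendsto_const_nhds hlim)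

end abstractForm

section kernels

instance inst_s8 : IsProbabilityMeasure μ01 := ⟨by simp [μ01]⟩

lemma Measurable.integrable_of_abs_le {α : Type*} [MeasurableSpace α] {μ : Measure α}
    [IsFiniteMeasure μ] {f : α → ℝ} (hf : Measurable f) {C : ℝ} (hC : ∀ x, |f x| ≤ C) :
    Integrable f μ :=
  Integrable.of_bound hf.aestronglyMeasurable C (Filter.Eventually.of_forall hC)

lemma abs_integral_le_of_abs_le {α : Type*} [MeasurableSpace α] {μ : Measure α}
    [IsProbabilityMeasure μ] {f : α → ℝ} {C : ℝ} (hC : ∀ x, |f x| ≤ C) :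
    |∫ x, f x ∂μ| ≤ C := by
  simpa using norm_integral_le_of_norm_le_const (μ := μ) (f := f) (C := C) (Filter.Eventually.of_forall hC)

lemma sq_integral_le_integral_sq {α : Type*} [MeasurableSpace α] {μ : Measure α}
    [IsProbabilityMeasure μ] {f : α → ℝ} (hf : Integrable f μ)
    (hf2 : Integrable (fun x => f x ^ 2) μ) : (∫ x, f x ∂μ) ^ 2 ≤ ∫ x, f x ^ 2 ∂μ := by
  set c := ∫ x, f x ∂μ with hc
  have h0 : 0 ≤ ∫ x, (f x - c) ^ 2 ∂μ := integral_nonneg fun x => sq_nonneg _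
  have h1 : ∫ x, (f x - c) ^ 2 ∂μ = ∫ x, f x ^ 2 ∂μ - c ^ 2 := by
    have : (fun x => (f x - c) ^ 2) = fun x => f x ^ 2 - (2 * c) * f x + c ^ 2 := by
      ext x; ring
    rw [this, integral_add (f := fun x => f x ^ 2 - (2 * c) * f x)
        (hf2.sub (hf.const_mul _)) (integrable_const _), integral_sub hf2 (hf.const_mul _), integral_const_mul, ← hc]
    simp
    ring
  linarith

/-- Bounded measurable kernels. -/
def boundedKernels : Submodule ℝ (ℝ × ℝ → ℝ) where
  carrier := {F | Measurable F ∧ ∃ C, ∀ p, |F p| ≤ C}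
  add_mem' := by
    rintro F G ⟨hF, C, hC⟩ ⟨hG, D, hD⟩
    exact ⟨hF.add hG, C + D, fun p => (abs_add_le _ _).trans (add_le_add (hC p) (hD p))⟩
  zero_mem' := ⟨measurable_const, 0, by simp⟩
  smul_mem' := by
    rintro c F ⟨hF, C, hC⟩
    refine ⟨hF.const_smul c, |c| * C, fun p => ?_⟩
    rw [Pi.smul_apply, smul_eq_mul, abs_mul]
    exact mul_le_mul_of_nonneg_left (hC p) (abs_nonneg c)

lemma boundedKernels.mul_mem {F G : ℝ × ℝ → ℝ} (hF : F ∈ boundedKernels)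
    (hG : G ∈ boundedKernels) : (fun p => F p * G p) ∈ boundedKernels := by
  obtain ⟨hF, C, hC⟩ := hF
  obtain ⟨hG, D, hD⟩ := hG
  refine ⟨hF.mul hG, C * D, fun p => ?_⟩
  rw [abs_mul]
  exact mul_le_mul (hC p) (hD p) (abs_nonneg _) ((abs_nonneg _).trans (hC p))

lemma boundedKernels.integrable_mul (F G : boundedKernels) :
    Integrable (fun p => F.1 p * G.1 p) (μ01.prod μ01) := by
  obtain ⟨h, C, hC⟩ := boundedKernels.mul_mem F.2 G.2
  exact h.integrable_of_abs_le hC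

/-- The `L²` form on bounded kernels. -/
def kernelForm : boundedKernels →ₗ[ℝ] boundedKernels →ₗ[ℝ] ℝ :=
  LinearMap.mk₂ ℝ (fun F G => ∫ p, F.1 p * G.1 p ∂(μ01.prod μ01))
    (fun F F' G => by
      rw [← integral_add (boundedKernels.integrable_mul F G)
        (boundedKernels.integrable_mul F' G)]
      simp [add_mul])
    (fun c F G => by
      rw [smul_eq_mul, ← integral_const_mul]
      simp [mul_assoc])
    (fun F G G' => by
      rw [← integral_add (boundedKernels.integrable_mul F G)
        (boundedKernels.integrable_mul F G')]
      simp [mul_add])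
    (fun c F G => by
      rw [smul_eq_mul, ← integral_const_mul]
      simp [mul_left_comm])

lemma kernelForm_apply (F G : boundedKernels) :
    kernelForm F G = ∫ p, F.1 p * G.1 p ∂(μ01.prod μ01) := rfl

lemma kernelForm_comm (F G : boundedKernels) : kernelForm F G = kernelForm G F := by
  simp only [kernelForm_apply, mul_comm]

lemma kernelForm_self_nonneg (F : boundedKernels) : 0 ≤ kernelForm F F :=
  integral_nonneg fun _ => mul_self_nonneg _

lemma IsGraphon.measurable_uncurry {W : ℝ → ℝ → ℝ} (hW : IsGraphon W) :
    Measurable fun p : ℝ × ℝ => W p.1 p.2 := hW.1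

lemma IsGraphon.abs_le_one {W : ℝ → ℝ → ℝ} (hW : IsGraphon W) (x y : ℝ) : |W x y| ≤ 1 :=
  abs_le.2 ⟨by linarith [(hW.2.2 x y).1], (hW.2.2 x y).2⟩

lemma IsGraphon.measurable_comp₂ {α : Type*} [MeasurableSpace α] {W : ℝ → ℝ → ℝ}
    (hW : IsGraphon W) {f g : α → ℝ} (hf : Measurable f) (hg : Measurable g) :
    Measurable fun a => W (f a) (g a) :=
  hW.measurable_uncurry.comp (hf.prodMk hg)

/-- A graphon as a bounded kernel. -/
def IsGraphon.toKernel {W : ℝ → ℝ → ℝ} (hW : IsGraphon W) : boundedKernels :=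
  ⟨fun p => W p.1 p.2, hW.measurable_uncurry, 1, fun _ => hW.abs_le_one _ _⟩

lemma abs_graphon_mul_le {W : ℝ → ℝ → ℝ} (hW : IsGraphon W) {r C : ℝ} (hr : |r| ≤ C) (x z : ℝ) :
    |W x z * r| ≤ C := by
  rw [abs_mul]
  have := mul_le_mul (hW.abs_le_one x z) hr (abs_nonneg r) zero_le_one
  linarith

/-- Composition with the integral operator of a graphon in the first variable. -/
def kernelOp {W : ℝ → ℝ → ℝ} (hW : IsGraphon W) : Module.End ℝ boundedKernels where
  toFun F := ⟨fun p => ∫ z, W p.1 z * F.1 (z, p.2) ∂μ01, by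
    obtain ⟨F, hF, C, hC⟩ := F
    refine ⟨?_, C, fun p => abs_integral_le_of_abs_le fun z => abs_graphon_mul_le hW (hC _) _ _⟩
    have h : Measurable fun q : (ℝ × ℝ) × ℝ => W q.1.1 q.2 * F (q.2, q.1.2) :=
      (hW.measurable_comp₂ (by fun_prop) (by fun_prop)).mul (hF.comp (by fun_prop))
    exact (h.stronglyMeasurable.integral_prod_right).measurable⟩
  map_add' F G := by
    have key (H : boundedKernels) (p : ℝ × ℝ) :
        Integrable (fun z => W p.1 z * H.1 (z, p.2)) μ01 := by
      obtain ⟨H, hH, C, hC⟩ := H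
      exact ((hW.measurable_comp₂ (by fun_prop) (by fun_prop)).mul
        (hH.comp (by fun_prop))).integrable_of_abs_le fun z => abs_graphon_mul_le hW (hC _) _ _
    ext p
    change ∫ z, W p.1 z * (F.1 (z, p.2) + G.1 (z, p.2)) ∂μ01 = _ + _
    simp only [mul_add]
    exact integral_add (key F p) (key G p)
  map_smul' c F := by
    ext p
    change ∫ z, W p.1 z * (c * F.1 (z, p.2)) ∂μ01 = c * _
    rw [← integral_const_mul]
    simp only [mul_left_comm]

lemma kernelOp_apply {W : ℝ → ℝ → ℝ} (hW : IsGraphon W) (F : boundedKernels) (p : ℝ × ℝ) :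
    (kernelOp hW F).1 p = ∫ z, W p.1 z * F.1 (z, p.2) ∂μ01 := rfl

lemma kernelForm_kernelOp {W : ℝ → ℝ → ℝ} (hW : IsGraphon W) (F G : boundedKernels) :
    kernelForm (kernelOp hW F) G = kernelForm F (kernelOp hW G) := by
  rw [kernelForm_apply, kernelForm_apply,
    integral_prod_symm _ (boundedKernels.integrable_mul (kernelOp hW F) G),
    integral_prod_symm _ (boundedKernels.integrable_mul F (kernelOp hW G))]
  congr 1
  ext y
  simp only [kernelOp_apply, ← integral_const_mul, ← integral_mul_const]
  rw [integral_integral_swap]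
  · refine integral_congr_ae (Filter.Eventually.of_forall fun z => ?_)
    refine integral_congr_ae (Filter.Eventually.of_forall fun x => ?_)
    change W x z * F.1 (z, y) * G.1 (x, y) = F.1 (z, y) * (W z x * G.1 (x, y))
    rw [hW.2.1 x z]
    ring
  · obtain ⟨F, hF, C, hC⟩ := F
    obtain ⟨G, hG, D, hD⟩ := G
    refine Measurable.integrable_of_abs_le (C := C * D) ?_ fun q => ?_
    · exact ((hW.measurable_comp₂ (by fun_prop) (by fun_prop)).mul
        (hF.comp (by fun_prop))).mul (hG.comp (by fun_prop))
    · change |W q.1 q.2 * F (q.2, y) * G (q.1, y)| ≤ _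
      rw [abs_mul]
      exact mul_le_mul (abs_graphon_mul_le hW (hC _) _ _) (hD _) (abs_nonneg _)
        ((abs_nonneg _).trans (hC (0, 0)))

lemma kernelForm_kernelOp_self_le {W : ℝ → ℝ → ℝ} (hW : IsGraphon W) (F : boundedKernels) :
    kernelForm (kernelOp hW F) (kernelOp hW F) ≤ kernelForm F F := by
  have hFF := boundedKernels.integrable_mul F F
  have hTT := boundedKernels.integrable_mul (kernelOp hW F) (kernelOp hW F)
  rw [kernelForm_apply, kernelForm_apply, integral_prod_symm _ hTT, integral_prod_symm _ hFF]
  refine integral_mono hTT.integral_prod_right hFF.integral_prod_right fun y => ?_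
  obtain ⟨F, hF, C, hC⟩ := F
  have hm (x : ℝ) : Measurable fun z => W x z * F (z, y) :=
    (hW.measurable_comp₂ (by fun_prop) (by fun_prop)).mul (hF.comp (by fun_prop))
  have hb (x z : ℝ) : |W x z * F (z, y)| ≤ C := abs_graphon_mul_le hW (hC _) _ _
  have hF2 : Integrable (fun z => F (z, y) * F (z, y)) μ01 := by
    have hm' : Measurable fun z => F (z, y) := hF.comp (by fun_prop)
    refine (hm'.mul hm').integrable_of_abs_le (C := C * C) fun z => ?_
    rw [Pi.mul_apply, abs_mul]
    exact mul_le_mul (hC _) (hC _) (abs_nonneg _) ((abs_nonneg _).trans (hC (0, 0)))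
  have hpt (x : ℝ) : (∫ z, W x z * F (z, y) ∂μ01) * (∫ z, W x z * F (z, y) ∂μ01) ≤
      ∫ z, F (z, y) * F (z, y) ∂μ01 := by
    have hi2 : Integrable (fun z => (W x z * F (z, y)) ^ 2) μ01 := by
      refine ((hm x).pow_const 2).integrable_of_abs_le (C := C ^ 2) fun z => ?_
      rw [abs_pow]
      exact pow_le_pow_left₀ (abs_nonneg _) (hb x z) 2
    rw [← pow_two]
    refine (sq_integral_le_integral_sq ((hm x).integrable_of_abs_le (hb x)) hi2).trans ?_
    refine integral_mono hi2 hF2 fun z => ?_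
    change (W x z * F (z, y)) ^ 2 ≤ F (z, y) * F (z, y)
    have h0 := (hW.2.2 x z).1
    have h1 := (hW.2.2 x z).2
    rw [mul_pow, ← pow_two]
    exact mul_le_of_le_one_left (sq_nonneg _) (pow_le_one₀ h0 h1)
  refine (le_abs_self _).trans (abs_integral_le_of_abs_le fun x => ?_)
  rw [abs_of_nonneg (mul_self_nonneg _)]
  exact hpt x

/-- The kernel of forward averaging over intervals of length `1 / (n + 1)`. -/
def averagingKernel (n : ℕ) : boundedKernels :=
  ⟨fun p => {p : ℝ × ℝ | p.2 ≤ p.1 ∧ p.1 ≤ p.2 + 1 / ((n : ℝ) + 1)}.indicator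
      (fun _ => (n : ℝ) + 1) p, by
    refine ⟨measurable_const.indicator ?_, n + 1, fun p => ?_⟩
    · exact (measurableSet_le measurable_snd measurable_fst).inter
        (measurableSet_le measurable_fst (measurable_snd.add_const _))
    · beta_reduce
      by_cases h : p ∈ {p : ℝ × ℝ | p.2 ≤ p.1 ∧ p.1 ≤ p.2 + 1 / ((n : ℝ) + 1)}
      · rw [indicator_of_mem h, abs_of_nonneg (by positivity)]
      · rw [indicator_of_notMem h, abs_zero]; positivity⟩

lemma kernelOp_averagingKernel {W : ℝ → ℝ → ℝ} (hW : IsGraphon W) (n : ℕ) (x y : ℝ) :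
    (kernelOp hW (averagingKernel n)).1 (x, y) =
      ⨍ z in Icc y (y + 1 / ((n : ℝ) + 1)), (Icc (0 : ℝ) 1).indicator (W x) z := by
  have hn : (0 : ℝ) < (n : ℝ) + 1 := by positivity
  rw [kernelOp_apply, setAverage_eq, smul_eq_mul, μ01, ← integral_indicator measurableSet_Icc,
    ← integral_indicator measurableSet_Icc, ← integral_const_mul]
  congr 1
  ext z
  have hvol : (volume.real (Icc y (y + 1 / ((n : ℝ) + 1))))⁻¹ = n + 1 := by
    rw [Real.volume_real_Icc_of_le (by linarith [one_div_pos.2 hn])]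
    field_simp
    ring
  rw [hvol]
  change (Icc (0 : ℝ) 1).indicator (fun z => W x z *
    {p : ℝ × ℝ | p.2 ≤ p.1 ∧ p.1 ≤ p.2 + 1 / ((n : ℝ) + 1)}.indicator
      (fun _ => (n : ℝ) + 1) (z, y)) z = _
  simp only [indicator_apply, mem_ofPred_eq, mem_Icc]
  split_ifs <;> ring

lemma abs_kernelOp_averagingKernel_le {W : ℝ → ℝ → ℝ} (hW : IsGraphon W) (n : ℕ) (p : ℝ × ℝ) :
    |(kernelOp hW (averagingKernel n)).1 p| ≤ 1 := by
  obtain ⟨x, y⟩ := p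
  have hn : (0 : ℝ) < (n : ℝ) + 1 := by positivity
  rw [kernelOp_averagingKernel, setAverage_eq, smul_eq_mul, abs_mul]
  have hv := Real.volume_real_Icc_of_le (a := y) (b := y + 1 / ((n : ℝ) + 1))
    (by linarith [one_div_pos.2 hn])
  have h := norm_setIntegral_le_of_norm_le_const (μ := volume) (C := 1)
    (f := (Icc (0 : ℝ) 1).indicator (W x)) (s := Icc y (y + 1 / ((n : ℝ) + 1)))
    measure_Icc_lt_top (fun z _ => (norm_indicator_le_norm_self _ _).trans (hW.abs_le_one x z))
  rw [one_mul, Real.norm_eq_abs] at h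
  rw [abs_of_nonneg (by positivity)]
  refine (mul_le_mul_of_nonneg_left h (by positivity)).trans ?_
  exact inv_mul_le_one

lemma ae_tendsto_kernelOp_averagingKernel {W : ℝ → ℝ → ℝ} (hW : IsGraphon W) :
    ∀ᵐ p ∂(μ01.prod μ01), Filter.Tendsto (fun n => (kernelOp hW (averagingKernel n)).1 p)
      Filter.atTop (nhds (W p.1 p.2)) := by
  have hmeas : MeasurableSet {p : ℝ × ℝ | Filter.Tendsto
      (fun n => (kernelOp hW (averagingKernel n)).1 p) Filter.atTop (nhds (W p.1 p.2))} :=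
    measurableSet_tendsto_fun (fun n => (kernelOp hW (averagingKernel n)).2.1)
      hW.measurable_uncurry
  rw [Measure.ae_prod_iff_ae_ae hmeas]
  refine Filter.Eventually.of_forall fun x => ?_
  have hloc : LocallyIntegrable ((Icc (0 : ℝ) 1).indicator (W x)) volume := by
    refine Integrable.locallyIntegrable ?_
    rw [integrable_indicator_iff measurableSet_Icc]
    exact (hW.measurable_comp₂ measurable_const measurable_id).integrable_of_abs_le
      (μ := μ01) (hW.abs_le_one x)
  rw [μ01, ae_restrict_iff' measurableSet_Icc]
  filter_upwards [(IsUnifLocDoublingMeasure.vitaliFamily (volume : Measure ℝ) 1).ae_tendsto_average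
    hloc] with y hy hy01
  rw [indicator_of_mem hy01] at hy
  simp only [kernelOp_averagingKernel]
  refine hy.comp ((Real.tendsto_Icc_vitaliFamily_right y).comp ?_)
  refine tendsto_nhdsWithin_iff.2 ⟨?_, Filter.Eventually.of_forall fun n => ?_⟩
  · simpa using tendsto_one_div_add_atTop_nhds_zero_nat.const_add y
  · exact lt_add_of_pos_right y (by positivity)

lemma exists_kernelForm_sub_kernelOp_lt {W : ℝ → ℝ → ℝ} (hW : IsGraphon W) {ε : ℝ} (hε : 0 < ε) :
    ∃ K, kernelForm (hW.toKernel - kernelOp hW K) (hW.toKernel - kernelOp hW K) < ε := by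
  have h : Filter.Tendsto (fun n => kernelForm (hW.toKernel - kernelOp hW (averagingKernel n))
      (hW.toKernel - kernelOp hW (averagingKernel n))) Filter.atTop (nhds 0) := by
    have h0 : (0 : ℝ) = ∫ _ : ℝ × ℝ, (0 : ℝ) ∂(μ01.prod μ01) := by simp
    rw [h0]
    refine tendsto_integral_of_dominated_convergence (fun _ => 2 * 2) (fun n => ?_)
      (integrable_const _) (fun n => Filter.Eventually.of_forall fun p => ?_) ?_
    · exact (boundedKernels.mul_mem (hW.toKernel - kernelOp hW (averagingKernel n)).2
        (hW.toKernel - kernelOp hW (averagingKernel n)).2).1.aestronglyMeasurable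
    · have h2 : |W p.1 p.2 - (kernelOp hW (averagingKernel n)).1 p| ≤ 2 := by
        refine (abs_sub _ _).trans ?_
        linarith [hW.abs_le_one p.1 p.2, abs_kernelOp_averagingKernel_le hW n p]
      rw [Real.norm_eq_abs, abs_mul]
      exact mul_le_mul h2 h2 (abs_nonneg _) (by norm_num)
    · filter_upwards [ae_tendsto_kernelOp_averagingKernel hW] with p hp
      have := hp.const_sub (W p.1 p.2)
      rw [sub_self] at this
      simpa [IsGraphon.toKernel] using this.mul this
  obtain ⟨n, hn⟩ := (h.eventually (gt_mem_nhds hε)).exists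
  exact ⟨_, hn⟩

end kernels

section cycles

/-- Weighting the end points of a path by a kernel. -/
lemma integral_path_eq {W : ℝ → ℝ → ℝ} (hW : IsGraphon W) (n : ℕ) (F : boundedKernels) :
    ∫ x : Fin (n + 2) → ℝ, F.1 (x 0, x (Fin.last _)) *
      ∏ i : Fin (n + 1), W (x i.castSucc) (x i.succ) ∂(Measure.pi fun _ => μ01) =
    kernelForm ((kernelOp hW ^ n) F) hW.toKernel := by
  induction n generalizing F with
  | zero =>
    rw [pow_zero, Module.End.one_apply, kernelForm_apply,
      ← (measurePreserving_finTwoArrow μ01).integral_comp']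
    simp [IsGraphon.toKernel, MeasurableEquiv.finTwoArrow]
  | succ n ih =>
    rw [pow_succ, Module.End.mul_apply, ← ih,
      ← (measurePreserving_piFinSuccAbove (fun _ : Fin (n + 3) => μ01) 0).symm.integral_comp']
    have hprod (x : Fin (n + 2) → ℝ) :
        |∏ i : Fin (n + 1), W (x i.castSucc) (x i.succ)| ≤ 1 := by
      rw [Finset.abs_prod]
      exact Finset.prod_le_one (fun _ _ => abs_nonneg _) fun _ _ => hW.abs_le_one _ _
    have hform (q : ℝ × (Fin (n + 2) → ℝ)) :
        (F.1 (((MeasurableEquiv.piFinSuccAbove (fun _ : Fin (n + 3) => ℝ) 0).symm q) 0,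
          ((MeasurableEquiv.piFinSuccAbove (fun _ : Fin (n + 3) => ℝ) 0).symm q) (Fin.last _)) *
        ∏ i : Fin (n + 2), W
          (((MeasurableEquiv.piFinSuccAbove (fun _ : Fin (n + 3) => ℝ) 0).symm q) i.castSucc)
          (((MeasurableEquiv.piFinSuccAbove (fun _ : Fin (n + 3) => ℝ) 0).symm q) i.succ)) =
        (W (q.2 0) q.1 * F.1 (q.1, q.2 (Fin.last _))) *
          ∏ i : Fin (n + 1), W (q.2 i.castSucc) (q.2 i.succ) := by
      have hq : (MeasurableEquiv.piFinSuccAbove (fun _ : Fin (n + 3) => ℝ) 0).symm q =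
          Fin.cons q.1 q.2 := by
        simp [MeasurableEquiv.piFinSuccAbove, Fin.insertNthEquiv]
      rw [hq, Fin.prod_univ_succ, ← Fin.succ_last]
      simp only [Fin.cons_succ, Fin.cons_zero, Fin.castSucc_zero, ← Fin.succ_castSucc]
      rw [hW.2.1 q.1]
      ring
    simp only [hform]
    rw [integral_prod_symm]
    · simp only [integral_mul_const, kernelOp_apply]
    · obtain ⟨F, hF, C, hC⟩ := F
      refine Measurable.integrable_of_abs_le (C := C) ?_ fun q => ?_
      · refine ((hW.measurable_comp₂ (by fun_prop) (by fun_prop)).mul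
          (hF.comp (by fun_prop))).mul ?_
        exact Finset.measurable_prod _ fun i _ => hW.measurable_comp₂ (by fun_prop) (by fun_prop)
      · rw [abs_mul]
        have := mul_le_mul (abs_graphon_mul_le hW (hC (q.1, q.2 (Fin.last _))) (q.2 0) q.1)
          (hprod q.2) (abs_nonneg _) ((abs_nonneg _).trans (hC (0, 0)))
        linarith

lemma cycleDensity_add_two {W : ℝ → ℝ → ℝ} (hW : IsGraphon W) (n : ℕ) :
    cycleDensity W (n + 2) = kernelForm ((kernelOp hW ^ n) hW.toKernel) hW.toKernel := by
  rw [← integral_path_eq, cycleDensity, volume_pi, Measure.restrict_pi_pi]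
  refine integral_congr_ae (Filter.Eventually.of_forall fun x => ?_)
  change ∏ i, W (x i) (x (finRotate (n + 2) i)) = W (x 0) (x (Fin.last _)) * _
  rw [Fin.prod_univ_castSucc, finRotate_last, hW.2.1, mul_comm]
  congr 1
  refine Finset.prod_congr rfl fun i _ => ?_
  rw [finRotate_apply, Fin.coeSucc_eq_succ]

lemma kernelForm_self_eq_of_cospectral {U W : ℝ → ℝ → ℝ} (hU : IsGraphon U) (hW : IsGraphon W)
    (h : ∀ k, 3 ≤ k → cycleDensity U k = cycleDensity W k) :
    kernelForm hU.toKernel hU.toKernel = kernelForm hW.toKernel hW.toKernel := by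
  have hlim {V : ℝ → ℝ → ℝ} (hV : IsGraphon V) :=
    tendsto_one_sub_sq_pow kernelForm kernelForm_comm kernelForm_self_nonneg (kernelOp hV)
      (kernelForm_kernelOp hV) (kernelForm_kernelOp_self_le hV) hV.toKernel
      (fun _ hε => exists_kernelForm_sub_kernelOp_lt hV hε)
  refine form_self_eq_of_moments_eq kernelForm (kernelOp hU) (kernelOp hW)
    (kernelForm_kernelOp hU) (kernelForm_kernelOp hW) _ _ (hlim hU) (hlim hW) fun k => ?_
  rw [← cycleDensity_add_two, ← cycleDensity_add_two]
  exact h _ (by omega)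

lemma ZeroOneValued.kernelForm_self {W : ℝ → ℝ → ℝ} (h : ZeroOneValued W) (hW : IsGraphon W) :
    kernelForm hW.toKernel hW.toKernel = L1norm W := by
  refine integral_congr_ae ?_
  filter_upwards [h] with p hp
  change W p.1 p.2 * W p.1 p.2 = |W p.1 p.2|
  rcases hp with hp | hp <;> simp [hp]

end cycles

lemma IsGraphon.integrable {W : ℝ → ℝ → ℝ} (hW : IsGraphon W) :
    Integrable (fun p : ℝ × ℝ => W p.1 p.2) (μ01.prod μ01) :=
  hW.measurable_uncurry.integrable_of_abs_le fun _ => hW.abs_le_one _ _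

lemma IsGraphon.L1norm_eq {W : ℝ → ℝ → ℝ} (hW : IsGraphon W) :
    L1norm W = ∫ p, W p.1 p.2 ∂(μ01.prod μ01) := by
  simp only [L1norm, fun x y => abs_of_nonneg (hW.2.2 x y).1]

lemma abs_L1norm_sub_le_cutNormDist {U W : ℝ → ℝ → ℝ} (hU : IsGraphon U) (hW : IsGraphon W) :
    |L1norm U - L1norm W| ≤ cutNormDist U W := by
  refine le_csSup ⟨1, ?_⟩ ⟨univ, univ, MeasurableSet.univ, MeasurableSet.univ, ?_⟩
  · rintro d ⟨S, T, -, -, rfl⟩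
    have h := norm_setIntegral_le_of_norm_le_const (μ := μ01.prod μ01) (s := S ×ˢ T) (C := 1)
      (f := fun p => U p.1 p.2 - W p.1 p.2) (measure_lt_top _ _) fun p _ => by
        have h1 := hU.2.2 p.1 p.2
        have h2 := hW.2.2 p.1 p.2
        exact abs_le.2 ⟨by linarith [h1.1, h2.2], by linarith [h1.2, h2.1]⟩
    rw [one_mul] at h
    exact h.trans measureReal_le_one
  · rw [univ_prod_univ, Measure.restrict_univ, integral_sub hU.integrable hW.integrable,
      hU.L1norm_eq, hW.L1norm_eq]

lemma IsGraphon.comp {W : ℝ → ℝ → ℝ} (hW : IsGraphon W) {φ : ℝ → ℝ} (hφ : Measurable φ) :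
    IsGraphon fun x y => W (φ x) (φ y) :=
  ⟨hW.measurable_comp₂ (hφ.comp measurable_fst) (hφ.comp measurable_snd),
    fun _ _ => hW.2.1 _ _, fun _ _ => hW.2.2 _ _⟩

lemma L1norm_comp {W : ℝ → ℝ → ℝ} (hW : IsGraphon W) {φ : ℝ → ℝ}
    (hφ : MeasurePreserving φ μ01 μ01) : L1norm (fun x y => W (φ x) (φ y)) = L1norm W := by
  have h := hφ.prod hφ
  rw [L1norm, L1norm]
  conv_rhs => rw [← h.map_eq]
  rw [integral_map h.measurable.aemeasurable]
  · rfl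
  · exact hW.measurable_uncurry.abs.aestronglyMeasurable

lemma abs_L1norm_sub_le_cutDist {U W : ℝ → ℝ → ℝ} (hU : IsGraphon U) (hW : IsGraphon W) :
    |L1norm U - L1norm W| ≤ cutDist U W := by
  refine le_csInf ⟨_, id, ⟨bijOn_id _, MeasurePreserving.id _⟩, rfl⟩ ?_
  rintro d ⟨φ, ⟨-, hφ⟩, rfl⟩
  rw [← L1norm_comp hU hφ]
  exact abs_L1norm_sub_le_cutNormDist (hU.comp hφ.measurable) hW

/-- Graphons with different `L¹`-norms cannot be cospectrally approximated by
`{0,1}`-valued graphons. -/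
theorem stmt8 (U W U' W' : ℝ → ℝ → ℝ)
    (hU : IsGraphon U) (hW : IsGraphon W) (hU' : IsGraphon U') (hW' : IsGraphon W')
    (h0U : ZeroOneValued U') (h0W : ZeroOneValued W')
    (hnorm : L1norm U > L1norm W)
    (hdU : cutDist U U' < (L1norm U - L1norm W) / 2)
    (hdW : cutDist W W' < (L1norm U - L1norm W) / 2) :
    ∃ k : ℕ, 3 ≤ k ∧ cycleDensity U' k ≠ cycleDensity W' k := by
  by_contra! hcos
  have h := kernelForm_self_eq_of_cospectral hU' hW' hcos
  rw [h0U.kernelForm_self, h0W.kernelForm_self] at h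
  have h1 := (abs_le.1 (abs_L1norm_sub_le_cutDist hU hU')).2
  have h2 := (abs_le.1 (abs_L1norm_sub_le_cutDist hW hW')).1
  linarith

end
end
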